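/- For every integer c ≥ 5, if G is a finite simple graph with mad(G) ≤ 4c/(c+2) and G does not contain K*_{c+1} as a subgraph, then G has a proper conflict-free c-coloring, i.e., χ_pcf(G) ≤ c. -/

import Mathlib

open SimpleGraph

/-- A proper conflict-free coloring with colors in `Fin c`. -/
def IsPCFColoring {V : Type*} {c : ℕ} (G : SimpleGraph V) (f : V → Fin c) : Prop :=
  (∀ ⦃u v : V⦄, G.Adj u v → f u ≠ f v) ∧
  ∀ v : V, (∃ u, G.Adj v u) →
    ∃ u, G.Adj v u ∧ ∀ w, G.Adj v w → f w = f u → w = u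

/-- `mad(G) ≤ q` : every nonempty subgraph has average degree at most `q`. -/
def MadLE {V : Type*} (G : SimpleGraph V) (q : ℚ) : Prop :=
  ∀ H : G.Subgraph, H.verts.Nonempty →
    (2 * H.edgeSet.ncard : ℚ) ≤ q * H.verts.ncard

def MadLT {V : Type*} (G : SimpleGraph V) (q : ℚ) : Prop :=
  ∀ H : G.Subgraph, H.verts.Nonempty →
    (2 * H.edgeSet.ncard : ℚ) < q * H.verts.ncard

/-- `G` contains a copy of `H` as a (not necessarily induced) subgraph. -/
def ContainsSubgraph {V W : Type*} (G : SimpleGraph V) (H : SimpleGraph W) : Prop :=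
  ∃ f : W → V, Function.Injective f ∧ ∀ ⦃a b : W⦄, H.Adj a b → G.Adj (f a) (f b)

/-- The 1-subdivision of a graph: subdivide every edge exactly once. -/
def Subdiv {V : Type*} (G : SimpleGraph V) : SimpleGraph (V ⊕ G.edgeSet) :=
  SimpleGraph.fromRel (fun a b =>
    match a, b with
    | Sum.inl v, Sum.inr e => v ∈ (e : Sym2 V)
    | _, _ => False)

/-- `K*_n`, the 1-subdivision of the complete graph on `n` vertices. -/
def KStarGraph (n : ℕ) : SimpleGraph (Fin n ⊕ (completeGraph (Fin n)).edgeSet) :=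
  Subdiv (completeGraph (Fin n))

/-- `G` is `c`-PCF-critical: `G` has no PCF `c`-coloring, but every proper
subgraph of `G` has one. -/
def PCFCritical {V : Type*} (G : SimpleGraph V) (c : ℕ) : Prop :=
  (¬ ∃ f : V → Fin c, IsPCFColoring G f) ∧
  ∀ H : G.Subgraph, H ≠ ⊤ → ∃ f : H.verts → Fin c, IsPCFColoring H.coe f

/-- `n_d(v)`: the number of neighbors of `v` having degree exactly `d`. -/
noncomputable def nDeg {V : Type*} [Fintype V] (G : SimpleGraph V) [DecidableRel G.Adj]
    (v : V) (d : ℕ) : ℕ :=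
  {u | G.Adj v u ∧ G.degree u = d}.ncard

/-- `n_{d+}(v)`: the number of neighbors of `v` having degree at least `d`. -/
noncomputable def nDegGE {V : Type*} [Fintype V] (G : SimpleGraph V) [DecidableRel G.Adj]
    (v : V) (d : ℕ) : ℕ :=
  {u | G.Adj v u ∧ d ≤ G.degree u}.ncard

/-- `f` is a proper coloring of the subgraph of `G` induced by `S`. -/
def IsProperOn {V : Type*} {c : ℕ} (G : SimpleGraph V) (S : Finset V) (f : V → Fin c) : Prop :=
  ∀ u ∈ S, ∀ v ∈ S, G.Adj u v → f u ≠ f v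

theorem List.exists_eq_append_first {α : Type*} {p : α → Prop} {l : List α} (h : ∃ x ∈ l, p x) :
    ∃ l₁ a l₂, l = l₁ ++ a :: l₂ ∧ p a ∧ ∀ x ∈ l₁, ¬ p x := by
  induction l with
  | nil => simp at h
  | cons b l ih =>
    by_cases hb : p b
    · exact ⟨[], b, l, by simp, hb, by simp⟩
    · obtain ⟨l₁, a, l₂, rfl, ha, hl⟩ := ih (by simpa [hb] using h)
      exact ⟨b :: l₁, a, l₂, by simp, ha, by simpa [hb] using hl⟩

theorem List.exists_eq_append_last {α : Type*} {p : α → Prop} {l : List α} (h : ∃ x ∈ l, p x) :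
    ∃ l₁ a l₂, l = l₁ ++ a :: l₂ ∧ p a ∧ ∀ x ∈ l₂, ¬ p x := by
  obtain ⟨l₁, a, l₂, hl, ha, hx⟩ :=
    List.exists_eq_append_first (p := p) (l := l.reverse) (by simpa using h)
  refine ⟨l₂.reverse, a, l₁.reverse, ?_, ha, by simpa using hx⟩
  rw [← List.reverse_reverse l, hl]
  simp

section Brooks

variable {V : Type*} {c : ℕ} {G : SimpleGraph V}

theorem IsProperOn.mono {S T : Finset V} {f : V → Fin c} (h : IsProperOn G T f) (hST : S ⊆ T) :
    IsProperOn G S f :=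
  fun u hu v hv => h u (hST hu) v (hST hv)

variable [DecidableEq V]

theorem IsProperOn.update {S : Finset V} {f : V → Fin c} (h : IsProperOn G S f) {v : V}
    {a : Fin c} (hv : v ∉ S) (ha : ∀ u ∈ S, G.Adj v u → f u ≠ a) :
    IsProperOn G (insert v S) (Function.update f v a) := by
  intro x hx y hy hxy
  rw [Finset.mem_insert] at hx hy
  rcases hx with rfl | hx <;> rcases hy with rfl | hy
  · exact absurd hxy (G.irrefl)
  · have : y ≠ x := by rintro rfl; exact hv hy
    simpa [this] using (ha y hy hxy).symm
  · have : x ≠ y := by rintro rfl; exact hv hx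
    simpa [this] using ha x hx hxy.symm
  · have h1 : x ≠ v := by rintro rfl; exact hv hx
    have h2 : y ≠ v := by rintro rfl; exact hv hy
    simpa [h1, h2] using h x hx y hy hxy

/-- Every path extends to one containing all neighbors of its last vertex. -/
theorem exists_maximal_path [Fintype V] (l₀ : List V) (hch : l₀.IsChain G.Adj) (hnd : l₀.Nodup) :
    ∃ l : List V, l₀ <+: l ∧ l.IsChain G.Adj ∧ l.Nodup ∧
      ∀ r ∈ l.getLast?, ∀ x, G.Adj r x → x ∈ l := by
  induction hn : Fintype.card V - l₀.length using Nat.strong_induction_on generalizing l₀ with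
  | _ n ih =>
    by_cases hex : ∀ r ∈ l₀.getLast?, ∀ x, G.Adj r x → x ∈ l₀
    · exact ⟨l₀, List.prefix_rfl, hch, hnd, hex⟩
    · push Not at hex
      obtain ⟨r, hr, x, hrx, hx⟩ := hex
      have hnd' : (l₀ ++ [x]).Nodup := by
        rw [List.nodup_append]
        refine ⟨hnd, by simp, ?_⟩
        rintro a ha b hb rfl
        simp at hb; subst hb; exact hx ha
      have hlen := hnd'.length_le_card
      obtain ⟨l, hl, h⟩ := ih _ (by simp at hlen ⊢; omega) (l₀ ++ [x]) (by
        rw [List.isChain_append]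
        refine ⟨hch, by simp, ?_⟩
        intro a ha b hb
        simp at hb; subst hb
        rw [Option.mem_def] at ha hr
        rw [ha] at hr
        cases hr; exact hrx) hnd' rfl
      exact ⟨l, (List.prefix_append _ _).trans hl, h⟩

variable [Fintype V] [DecidableRel G.Adj]

theorem IsProperOn.exists_insert {S : Finset V} {f : V → Fin c} (h : IsProperOn G S f) {v : V}
    (hv : v ∉ S) (hcard : ((G.neighborFinset v ∩ S).image f).card < c) :
    ∃ g : V → Fin c, (∀ x ∈ S, g x = f x) ∧ IsProperOn G (insert v S) g := by
  obtain ⟨a, ha⟩ : ∃ a, a ∉ (G.neighborFinset v ∩ S).image f := by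
    by_contra! hcon
    have : (Finset.univ : Finset (Fin c)).card ≤ _ := Finset.card_le_card fun a _ => hcon a
    simp at this
    omega
  refine ⟨Function.update f v a, fun x hx => ?_, h.update hv fun u hu hvu hfu => ha ?_⟩
  · exact Function.update_of_ne (by rintro rfl; exact hv hx) _ _
  · exact Finset.mem_image.2 ⟨u, by simp [hu, hvu], hfu⟩

/-- A partial coloring extends along a path of uncolored vertices, up to its last vertex. -/
theorem IsProperOn.exists_append_path (hdeg : ∀ v, G.degree v ≤ c) (l : List V) (b : V)
    {S : Finset V} {f : V → Fin c} (h : IsProperOn G S f) (hch : (l ++ [b]).IsChain G.Adj)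
    (hnd : (l ++ [b]).Nodup) (hdis : ∀ x ∈ l ++ [b], x ∉ S) :
    ∃ g : V → Fin c, (∀ x ∈ S, g x = f x) ∧ IsProperOn G (S ∪ l.toFinset) g := by
  induction l generalizing S f with
  | nil => exact ⟨f, by simp, by simpa using h⟩
  | cons a l ih =>
    have haS : a ∉ S := hdis a (by simp)
    obtain ⟨n, hn, han⟩ : ∃ n ∈ l ++ [b], G.Adj a n := by
      cases l with
      | nil => exact ⟨b, by simp, by simpa using hch⟩
      | cons d l => exact ⟨d, by simp, by simp at hch; exact hch.1⟩
    have hnS : n ∉ S := hdis n (by simp at hn ⊢; tauto)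
    have hcard : (G.neighborFinset a ∩ S).card < c := by
      refine lt_of_lt_of_le (Finset.card_lt_card ?_) (hdeg a)
      refine Finset.ssubset_iff_subset_ne.2 ⟨Finset.inter_subset_left, fun h => ?_⟩
      have hmem : n ∈ G.neighborFinset a ∩ S := by rw [h]; simpa using han
      exact hnS (Finset.mem_inter.1 hmem).2
    obtain ⟨g, hg, hgp⟩ := h.exists_insert haS (Finset.card_image_le.trans_lt hcard)
    simp only [List.cons_append, List.nodup_cons] at hnd
    obtain ⟨g', hg', hgp'⟩ := ih hgp (by
      simp only [List.cons_append] at hch; exact hch.tail) hnd.2 (by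
      intro x hx
      simp only [Finset.mem_insert, not_or]
      exact ⟨by rintro rfl; exact hnd.1 hx, hdis x (by simp at hx ⊢; tauto)⟩)
    refine ⟨g', fun x hx => (hg' x (by simp [hx])).trans (hg x hx), ?_⟩
    convert hgp' using 1
    ext; simp

/-- A vertex of degree at most `c` with two neighbors of the same color can be colored. -/
theorem IsProperOn.exists_insert_of_eq (hdeg : ∀ v, G.degree v ≤ c) {S : Finset V}
    {f : V → Fin c} (h : IsProperOn G S f) {w p q : V} (hw : w ∉ S)
    (hpq : p ≠ q) (hp : G.Adj w p) (hq : G.Adj w q) (hf : f p = f q) :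
    ∃ g : V → Fin c, IsProperOn G (insert w S) g := by
  suffices ((G.neighborFinset w ∩ S).image f).card < c by
    obtain ⟨g, -, hg⟩ := h.exists_insert hw this
    exact ⟨g, hg⟩
  have hsub : (G.neighborFinset w ∩ S).image f ⊆ ((G.neighborFinset w).erase q).image f := by
    intro a ha
    obtain ⟨x, hx, rfl⟩ := Finset.mem_image.1 ha
    by_cases hxq : x = q
    · subst hxq
      exact Finset.mem_image.2 ⟨p, by simp [hp, hpq], hf⟩
    · exact Finset.mem_image_of_mem _ (by simp at hx ⊢; tauto)
  have := (Finset.card_le_card hsub).trans Finset.card_image_le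
  rw [Finset.card_erase_of_mem (by simpa using hq)] at this
  have hd := hdeg w
  have hpos : 0 < (G.neighborFinset w).card := Finset.card_pos.2 ⟨p, by simpa using hp⟩
  rw [card_neighborFinset_eq_degree] at this hpos
  omega

/-- A graph of maximum degree at most `c` with a spanning path that starts with an induced path
`x, v, y`, where `v` has a further neighbor, is `c`-colorable. -/
theorem exists_isProperOn_of_path (hc : 0 < c) (hdeg : ∀ v, G.degree v ≤ c) {x v y j : V}
    {R : List V} (hch : ([x, v, y] ++ R).IsChain G.Adj) (hnd : ([x, v, y] ++ R).Nodup)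
    (hnxy : ¬ G.Adj x y) (hvj : G.Adj v j) (hjR : j ∈ R) :
    ∃ g : V → Fin c, IsProperOn G ([x, v, y] ++ R).toFinset g := by
  have hvx : G.Adj v x := by simp at hch; exact hch.1.symm
  have hvy : G.Adj v y := by simp at hch; exact hch.2.1
  have hxy : x ≠ y := by simp at hnd; tauto
  obtain ⟨R₁, R₂, rfl⟩ := List.append_of_mem hjR
  have hp0 : IsProperOn G {x, y} (fun _ => (⟨0, by omega⟩ : Fin c)) := by
    intro a ha b hb hab
    simp at ha hb
    rcases ha with rfl | rfl <;> rcases hb with rfl | rfl <;>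
      first | exact absurd hab G.irrefl | exact absurd hab hnxy | exact absurd hab.symm hnxy
  have hch2 : (R₁ ++ j :: R₂).IsChain G.Adj := hch.right_of_append
  have hnd2 : (R₁ ++ j :: R₂).Nodup := (List.nodup_append.1 hnd).2.1
  have hchj : (j :: R₂).IsChain G.Adj := hch2.right_of_append
  have hdisj : ∀ z ∈ R₁ ++ j :: R₂, z ≠ x ∧ z ≠ v ∧ z ≠ y := by
    intro z hz
    have := (List.nodup_append.1 hnd).2.2
    exact ⟨(this x (by simp) z hz).symm, (this v (by simp) z hz).symm,
      (this y (by simp) z hz).symm⟩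
  obtain ⟨g₁, hg₁, hgp₁⟩ := hp0.exists_append_path hdeg R₁ j
    (by
      have : (R₁ ++ [j]) <+: (R₁ ++ j :: R₂) := ⟨R₂, by simp⟩
      exact hch2.prefix this)
    (by
      have : (R₁ ++ [j]).Sublist (R₁ ++ j :: R₂) := by simp
      exact hnd2.sublist this)
    (by
      intro z hz
      have := hdisj z (by simp at hz ⊢; tauto)
      simp; tauto)
  obtain ⟨g₂, hg₂, hgp₂⟩ := hgp₁.exists_append_path hdeg (R₂.reverse ++ [j]) v
    (by
      rw [List.isChain_append]
      refine ⟨?_, by simp, ?_⟩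
      · rw [← List.reverse_cons, List.isChain_reverse]
        exact hchj.imp fun _ _ h => h.symm
      · intro a ha b hb
        simp at ha hb
        subst ha hb
        exact hvj.symm)
    (by
      rw [← List.reverse_cons, List.nodup_append]
      refine ⟨List.nodup_reverse.2 (List.nodup_append.1 hnd2).2.1, by simp, ?_⟩
      intro a ha b hb
      simp only [List.mem_singleton] at hb
      subst hb
      exact (hdisj a (by simp at ha ⊢; tauto)).2.1)
    (by
      intro z hz
      have hz' : z = v ∨ z ∈ j :: R₂ := by simp at hz ⊢; tauto
      rw [Finset.mem_union, List.mem_toFinset, not_or]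
      rcases hz' with rfl | hz'
      · exact ⟨by simp [hvx.ne, hvy.ne], fun h => (hdisj z (by simp [h])).2.1 rfl⟩
      · have := hdisj z (List.mem_append_right _ hz')
        exact ⟨by simp; tauto, fun h => (List.nodup_append.1 hnd2).2.2 z h z hz' rfl⟩)
  have hvn : v ∉ R₁ ++ j :: R₂ := fun h => (hdisj v h).2.1 rfl
  obtain ⟨g, hg⟩ := hgp₂.exists_insert_of_eq hdeg (w := v) (p := x) (q := y)
    (by simp at hvn ⊢; simp [hvx.ne, hvy.ne, hvn]) hxy hvx hvy (by
      rw [hg₂ x (by simp), hg₂ y (by simp), hg₁ x (by simp), hg₁ y (by simp)])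
  refine ⟨g, hg.mono fun z hz => ?_⟩
  simp at hz ⊢; tauto

/-- A partial coloring extends to an uncolored cycle if the cycle has consecutive vertices `w`, `u`
such that `w` has a colored neighbor and `u` has none. -/
theorem IsProperOn.exists_union_cycle (hdeg : ∀ v, G.degree v ≤ c) {S : Finset V} {f : V → Fin c}
    (hf : IsProperOn G S f) {B E : List V} {w u t : V} (hch : (B ++ w :: u :: E).IsChain G.Adj)
    (hnd : (B ++ w :: u :: E).Nodup)
    (hcyc : ∀ a ∈ (B ++ w :: u :: E).getLast?, ∀ b ∈ (B ++ w :: u :: E).head?, G.Adj a b)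
    (hdis : Disjoint S (B ++ w :: u :: E).toFinset) (ht : t ∈ S) (hwt : G.Adj w t)
    (hu : ∀ z ∈ S, ¬ G.Adj u z) :
    ∃ g : V → Fin c, IsProperOn G (S ∪ (B ++ w :: u :: E).toFinset) g := by
  have hS : ∀ z ∈ B ++ w :: u :: E, z ∉ S := fun z hz hzS =>
    Finset.disjoint_left.1 hdis hzS (List.mem_toFinset.2 hz)
  have huS : u ∉ S := hS u (by simp)
  have hwS : w ∉ S := hS w (by simp)
  have hfu := hf.update (v := u) (a := f t) huS fun z hz huz => absurd huz (hu z hz)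
  have hnd' : (u :: ((E ++ B) ++ [w])).Nodup :=
    (List.Perm.nodup_iff (by
      have : (B ++ w :: u :: E) = (B ++ [w]) ++ (u :: E) := by simp
      rw [this]
      refine List.perm_append_comm.trans ?_
      simp)).1 hnd
  rw [List.nodup_cons] at hnd'
  obtain ⟨g, hg, hgp⟩ := hfu.exists_append_path hdeg (E ++ B) w
    (by
      rw [List.append_assoc, List.isChain_append]
      refine ⟨hch.right_of_append.tail.tail, hch.prefix ⟨u :: E, by simp⟩, ?_⟩
      intro a ha b hb
      rw [Option.mem_def] at ha hb
      refine hcyc a ?_ b ?_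
      · have : (B ++ w :: u :: E) = (B ++ [w, u]) ++ E := by simp
        rw [this, List.getLast?_append, ha]; rfl
      · have : (B ++ w :: u :: E) = (B ++ [w]) ++ (u :: E) := by simp
        rw [this, List.head?_append, hb]; rfl)
    hnd'.2
    (by
      intro z hz
      have hzu : z ≠ u := by rintro rfl; exact hnd'.1 hz
      have hzS : z ∉ S := hS z (by simp at hz ⊢; tauto)
      simp [hzu, hzS])
  have htu : t ≠ u := by rintro rfl; exact huS ht
  have hwEB : w ∉ E ++ B := fun h => (List.nodup_append.1 hnd'.2).2.2 w h w (by simp) rfl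
  have hwu : w ≠ u := by rintro rfl; exact hnd'.1 (by simp)
  obtain ⟨g', hg'⟩ := hgp.exists_insert_of_eq hdeg (w := w) (p := t) (q := u)
    (by rw [Finset.mem_union, Finset.mem_insert, List.mem_toFinset]; tauto) htu hwt
    (by
      have := hch.right_of_append
      rw [List.isChain_cons_cons] at this
      exact this.1)
    (by
      rw [hg t (Finset.mem_insert_of_mem ht), hg u (Finset.mem_insert_self _ _)]
      simp [htu])
  refine ⟨g', hg'.mono fun z hz => ?_⟩
  simp at hz ⊢; tauto

/-- The theorem of Brooks. -/
theorem brooks (hc : 3 ≤ c) (hdeg : ∀ v, G.degree v ≤ c) (hK : G.CliqueFree (c + 1)) :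
    ∃ f : V → Fin c, ∀ u v, G.Adj u v → f u ≠ f v := by
  suffices ∀ A : Finset V, ∃ f : V → Fin c, IsProperOn G A f by
    obtain ⟨f, hf⟩ := this Finset.univ
    exact ⟨f, fun u v => hf u (by simp) v (by simp)⟩
  intro A
  induction A using Finset.strongInduction with
  | H A ih =>
  by_contra hA
  have hnbr : ∀ v ∈ A, G.degree v = c ∧ ∀ x, G.Adj v x → x ∈ A := by
    intro v hv
    obtain ⟨f, hf⟩ := ih (A.erase v) (Finset.erase_ssubset hv)
    have h1 : ¬ ((G.neighborFinset v ∩ A.erase v).image f).card < c := fun h => by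
      obtain ⟨g, -, hg⟩ := hf.exists_insert (by simp) h
      exact hA ⟨g, by rwa [Finset.insert_erase hv] at hg⟩
    have h2 := (not_lt.1 h1).trans Finset.card_image_le
    have h3 : G.neighborFinset v ∩ A.erase v = G.neighborFinset v :=
      Finset.eq_of_subset_of_card_le Finset.inter_subset_left
        (by rw [card_neighborFinset_eq_degree]; exact (hdeg v).trans h2)
    rw [h3, card_neighborFinset_eq_degree] at h2
    refine ⟨le_antisymm (hdeg v) h2, fun x hx => ?_⟩
    have : x ∈ G.neighborFinset v ∩ A.erase v := by rw [h3]; simpa using hx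
    simp at this; tauto
  -- an induced path on three vertices
  obtain ⟨v, hv⟩ : A.Nonempty := by
    rw [Finset.nonempty_iff_ne_empty]
    rintro rfl
    exact hA ⟨fun _ => ⟨0, by omega⟩, by simp [IsProperOn]⟩
  obtain ⟨x, y, hvx, hvy, hxy, hnxy⟩ :
      ∃ x y, G.Adj v x ∧ G.Adj v y ∧ x ≠ y ∧ ¬ G.Adj x y := by
    by_contra! hcon
    refine hK (insert v (G.neighborFinset v)) ⟨?_, ?_⟩
    · rw [Finset.coe_insert, isClique_insert]
      refine ⟨fun a ha b hb hab => hcon a b (by simpa using ha) (by simpa using hb) hab, ?_⟩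
      intro b hb _
      simpa using hb
    · rw [Finset.card_insert_of_notMem (by simp), card_neighborFinset_eq_degree, (hnbr v hv).1]
  obtain ⟨l, ⟨R, rfl⟩, hch, hnd, hmax⟩ := exists_maximal_path (G := G) [x, v, y]
    (by simp [hvx.symm, hvy]) (by simp [hvx.ne', hvy.ne, hxy])
  -- vertices of the path
  have hlA : ∀ z ∈ [x, v, y] ++ R, z ∈ A := by
    have key : ∀ (l : List V) (a : V), a ∈ A → (a :: l).IsChain G.Adj → ∀ z ∈ a :: l, z ∈ A := by
      intro l
      induction l with
      | nil => simp
      | cons b l ih' =>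
        intro a ha h z hz
        rw [List.isChain_cons_cons] at h
        rcases List.mem_cons.1 hz with rfl | hz
        · exact ha
        · exact ih' b ((hnbr a ha).2 b h.1) h.2 z hz
    exact key _ x ((hnbr v hv).2 x hvx) hch
  obtain ⟨l', r, hl⟩ : ∃ l' r, [x, v, y] ++ R = l' ++ [r] := by
    rcases List.eq_nil_or_concat ([x, v, y] ++ R) with h | ⟨l', r, h⟩
    · simp at h
    · exact ⟨l', r, by simpa using h⟩
  have hr : ∀ z, G.Adj r z → z ∈ l' := by
    intro z hz
    have := hmax r (by rw [hl]; simp) z hz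
    rw [hl] at this
    simp at this
    rcases this with h | rfl
    · exact h
    · exact absurd hz G.irrefl
  have hrA : r ∈ A := hlA r (by rw [hl]; simp)
  obtain ⟨E, m, B, hl', hrm, hE⟩ :=
    List.exists_eq_append_first (p := fun z => G.Adj r z) (l := l') (by
      have : 0 < G.degree r := by rw [(hnbr r hrA).1]; omega
      obtain ⟨z, hz⟩ := (G.degree_pos_iff_exists_adj r).1 this
      exact ⟨z, hr z hz, hz⟩)
  have hlE : [x, v, y] ++ R = E ++ (m :: B ++ [r]) := by rw [hl, hl']; simp
  have hndE := hnd
  rw [hlE, List.nodup_append] at hndE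
  have hchE := hch
  rw [hlE] at hchE
  have hrC : ∀ z, G.Adj r z → z ∈ m :: B ++ [r] := by
    intro z hz
    have := hr z hz
    rw [hl', List.mem_append] at this
    rcases this with h | h
    · exact absurd hz (hE z h)
    · simp at h ⊢; tauto
  have hCA : ∀ z ∈ m :: B ++ [r], z ∈ A := fun z hz => hlA z (by
    rw [hlE]; exact List.mem_append_right _ hz)
  have hchC := hchE.right_of_append
  by_cases hclosed : ∀ u ∈ m :: B ++ [r], ∀ z, G.Adj u z → z ∈ m :: B ++ [r]
  · -- the cycle spans `A`
    have hAC : A ⊆ (m :: B ++ [r]).toFinset := by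
      by_contra hne
      have hsub : (m :: B ++ [r]).toFinset ⊂ A :=
        ⟨fun z hz => hCA z (List.mem_toFinset.1 hz), hne⟩
      obtain ⟨f₁, hf₁⟩ := ih _ hsub
      obtain ⟨f₂, hf₂⟩ := ih (A \ (m :: B ++ [r]).toFinset)
        (Finset.sdiff_ssubset hsub.1 ⟨m, by simp⟩)
      refine hA ⟨fun z => if z ∈ m :: B ++ [r] then f₁ z else f₂ z, ?_⟩
      intro a ha b hb hab
      by_cases h1 : a ∈ m :: B ++ [r]
      · have h2 := hclosed a h1 b hab
        simp only [h1, h2, if_true]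
        exact hf₁ a (List.mem_toFinset.2 h1) b (List.mem_toFinset.2 h2) hab
      · have h2 : b ∉ m :: B ++ [r] := fun h2 => h1 (hclosed b h2 a hab.symm)
        simp only [h1, h2, if_false]
        exact hf₂ a (by rw [Finset.mem_sdiff, List.mem_toFinset]; exact ⟨ha, h1⟩) b
          (by rw [Finset.mem_sdiff, List.mem_toFinset]; exact ⟨hb, h2⟩) hab
    have hAl : ∀ z ∈ A, z ∈ [x, v, y] ++ R := fun z hz => by
      rw [hlE]; exact List.mem_append_right _ (List.mem_toFinset.1 (hAC hz))
    obtain ⟨j, hvj, hjx, hjy⟩ : ∃ j, G.Adj v j ∧ j ≠ x ∧ j ≠ y := by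
      by_contra! hcon
      have : G.neighborFinset v ⊆ {x, y} := fun j hj => by
        have := hcon j (by simpa using hj)
        simp; tauto
      have := Finset.card_le_card this
      rw [card_neighborFinset_eq_degree, (hnbr v hv).1] at this
      have := this.trans Finset.card_le_two
      omega
    have hjR : j ∈ R := by
      have := hAl j ((hnbr v hv).2 j hvj)
      simp [hjx, hjy, hvj.ne'] at this
      exact this
    obtain ⟨g, hg⟩ := exists_isProperOn_of_path (by omega) hdeg hch hnd hnxy hvj hjR
    exact hA ⟨g, hg.mono fun z hz => List.mem_toFinset.2 (hAl z hz)⟩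
  · push Not at hclosed
    obtain ⟨B₁, w, E₁, hC, ⟨t, hwt, ht⟩, hE₁⟩ := List.exists_eq_append_last
      (p := fun u => ∃ z, G.Adj u z ∧ z ∉ m :: B ++ [r]) hclosed
    push Not at hE₁
    have hlast : (B₁ ++ w :: E₁).getLast? = some r := by rw [← hC]; exact List.getLast?_concat
    cases E₁ with
    | nil =>
      have : w = r := by simpa using hlast
      subst this
      exact absurd (hrC t hwt) ht
    | cons u E₂ =>
      have hdisj : Disjoint (A \ (m :: B ++ [r]).toFinset) (m :: B ++ [r]).toFinset :=
        Finset.sdiff_disjoint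
      have hwC : w ∈ m :: B ++ [r] := by rw [hC]; simp
      obtain ⟨f, hf⟩ := ih (A \ (m :: B ++ [r]).toFinset)
        (Finset.sdiff_ssubset (fun z hz => hCA z (List.mem_toFinset.1 hz)) ⟨m, by simp⟩)
      obtain ⟨g, hg⟩ := hf.exists_union_cycle hdeg (t := t) (hC ▸ hchC) (hC ▸ hndE.2.1)
        (by
          rw [← hC]
          intro a ha b hb
          rw [Option.mem_def, List.getLast?_concat, Option.some.injEq] at ha
          rw [Option.mem_def, List.cons_append, List.head?_cons, Option.some.injEq] at hb
          subst ha hb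
          exact hrm)
        (hC ▸ hdisj)
        (by
          rw [Finset.mem_sdiff, List.mem_toFinset]
          exact ⟨(hnbr w (hCA w hwC)).2 t hwt, ht⟩)
        hwt
        (by
          intro z hz huz
          rw [Finset.mem_sdiff, List.mem_toFinset] at hz
          exact hz.2 (hE₁ u (by simp) z huz))
      refine hA ⟨g, hg.mono fun z hz => ?_⟩
      rw [← hC, Finset.sdiff_union_self_eq_union]
      exact Finset.mem_union_left _ hz

end Brooks

section PartialColoring

variable {V : Type*} {c : ℕ} (G : SimpleGraph V)

/-- Some color appears on exactly one of the neighbors of `t` in `S`. -/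
def HasUniqueColor (S : Finset V) (f : V → Fin c) (t : V) : Prop :=
  ∃ u ∈ S, G.Adj t u ∧ ∀ w ∈ S, G.Adj t w → f w = f u → w = u

/-- `f` is a proper coloring of `S`, and every vertex outside `W` that has neighbors in `S` has a
color appearing on exactly one of them. -/
structure IsPartialPCF (S : Finset V) (f : V → Fin c) (W : Finset V) : Prop where
  proper : IsProperOn G S f
  unique : ∀ t ∉ W, (∃ u ∈ S, G.Adj t u) → HasUniqueColor G S f t

/-- The colors to be avoided by a new neighbor of `t` so that `t` has a unique color afterwards. -/
noncomputable def blockedColors (S : Finset V) (f : V → Fin c) (t : V) : Finset (Fin c) :=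
  open scoped Classical in
  if h : HasUniqueColor G S f t then {f h.choose} else (S.filter (G.Adj t)).image f

variable {G} {S W W' : Finset V} {f : V → Fin c} {t v : V}

theorem card_blockedColors_le_one (h : (∃ u ∈ S, G.Adj t u) → HasUniqueColor G S f t) :
    (blockedColors G S f t).card ≤ 1 := by
  unfold blockedColors
  split_ifs with hu
  · simp
  · have : ∀ u ∈ S, ¬ G.Adj t u := fun u hu' hadj => hu (h ⟨u, hu', hadj⟩)
    rw [Finset.card_eq_zero.2 (by simpa [Finset.filter_eq_empty_iff] using this)]
    exact zero_le_one

theorem hasUniqueColor_congr {S' : Finset V} {g : V → Fin c}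
    (hS : ∀ u, G.Adj t u → (u ∈ S' ↔ u ∈ S)) (hg : ∀ u ∈ S, G.Adj t u → g u = f u)
    (h : HasUniqueColor G S f t) : HasUniqueColor G S' g t := by
  obtain ⟨u, hu, htu, huniq⟩ := h
  refine ⟨u, (hS u htu).2 hu, htu, fun w hw htw hfw => ?_⟩
  have hw' := (hS w htw).1 hw
  rw [hg w hw' htw, hg u hu htu] at hfw
  exact huniq w hw' htw hfw

variable [DecidableEq V]

theorem IsPartialPCF.of_unique (h : IsPartialPCF G S f W)
    (hW : ∀ t ∈ W, t ∉ W' → (∃ u ∈ S, G.Adj t u) → HasUniqueColor G S f t) :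
    IsPartialPCF G S f W' :=
  ⟨h.proper, fun t ht => if htW : t ∈ W then hW t htW ht else h.unique t htW⟩

theorem hasUniqueColor_update {a : Fin c} (hv : v ∉ S) (htv : G.Adj t v)
    (ha : a ∉ blockedColors G S f t) :
    HasUniqueColor G (insert v S) (Function.update f v a) t := by
  unfold blockedColors at ha
  split_ifs at ha with hu
  · obtain ⟨hS, hadj, huniq⟩ := hu.choose_spec
    set u := hu.choose
    have huv : u ≠ v := by rintro h; exact hv (h ▸ hS)
    refine ⟨u, by simp [hS], hadj, fun w hw htw hfw => ?_⟩
    rcases Finset.mem_insert.1 hw with rfl | hwS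
    · simp [huv] at hfw ha
      exact absurd hfw ha
    · have hwv : w ≠ v := by rintro rfl; exact hv hwS
      simp [huv, hwv] at hfw
      exact huniq w hwS htw hfw
  · refine ⟨v, by simp, htv, fun w hw htw hfw => ?_⟩
    by_contra hwv
    have hwS : w ∈ S := by simpa [hwv] using hw
    simp [hwv] at hfw
    exact ha (Finset.mem_image.2 ⟨w, by simp [hwS, htw], hfw⟩)

variable [Fintype V] [DecidableRel G.Adj]

theorem hasUniqueColor_of_card_le_one (h : (G.neighborFinset t ∩ S).card ≤ 1)
    (hex : ∃ u ∈ S, G.Adj t u) : HasUniqueColor G S f t := by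
  obtain ⟨u, hu, htu⟩ := hex
  refine ⟨u, hu, htu, fun w hw htw _ => ?_⟩
  exact Finset.card_le_one.1 h w (by simp [hw, htw]) u (by simp [hu, htu])

/-- A vertex of degree at most three with two differently colored neighbors has a unique color. -/
theorem hasUniqueColor_of_ne {p q : V} (h : G.degree t ≤ 3) (hp : p ∈ S) (hq : q ∈ S)
    (htp : G.Adj t p) (htq : G.Adj t q) (hpq : f p ≠ f q) : HasUniqueColor G S f t := by
  by_contra hcon
  simp only [HasUniqueColor, not_exists, not_and, not_forall] at hcon
  obtain ⟨p', hp', htp', hfp, hpp⟩ := hcon p hp htp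
  obtain ⟨q', hq', htq', hfq, hqq⟩ := hcon q hq htq
  have hsub : ({p, q, p', q'} : Finset V) ⊆ G.neighborFinset t := by
    intro x hx
    simp at hx ⊢
    rcases hx with rfl | rfl | rfl | rfl <;> assumption
  have hcard := Finset.card_le_card hsub
  have h1 : p ≠ q := by rintro rfl; exact hpq rfl
  have h2 : p ≠ q' := by rintro rfl; exact hpq hfq
  have h3 : q ≠ p' := by rintro rfl; exact hpq hfp.symm
  have h4 : p' ≠ q' := by rintro rfl; exact hpq (hfp.symm.trans hfq)
  rw [card_neighborFinset_eq_degree, Finset.card_insert_of_notMem, Finset.card_insert_of_notMem,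
    Finset.card_pair h4] at hcard
  · omega
  · simpa using ⟨h3, Ne.symm hqq⟩
  · simpa using ⟨h1, Ne.symm hpp, h2⟩

theorem card_blockedColors_le (S : Finset V) (f : V → Fin c) (t : V) :
    (blockedColors G S f t).card ≤ max 1 ((G.neighborFinset t ∩ S).card / 2) := by
  by_cases hu : HasUniqueColor G S f t
  · exact (card_blockedColors_le_one fun _ => hu).trans (le_max_left _ _)
  · refine le_trans ?_ (le_max_right _ _)
    have hE : blockedColors G S f t = (G.neighborFinset t ∩ S).image f := by
      unfold blockedColors
      rw [dif_neg hu]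
      congr 1
      ext; simp [and_comm]
    rw [hE, Nat.le_div_iff_mul_le two_pos, mul_comm]
    refine Finset.mul_card_image_le_card _ _ fun a ha => ?_
    obtain ⟨u, hu', rfl⟩ := Finset.mem_image.1 ha
    simp only [HasUniqueColor, not_exists, not_and, not_forall] at hu
    rw [Finset.mem_inter, mem_neighborFinset] at hu'
    obtain ⟨w, hw, htw, hfw, hwu⟩ := hu u hu'.2 hu'.1
    exact Finset.one_lt_card.2 ⟨w, by simp [hw, htw, hfw], u, by simp [hu'], hwu⟩

/-- Color one more vertex `v`, settling all vertices outside `W'`. -/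
theorem IsPartialPCF.exists_insert (h : IsPartialPCF G S f W) (hv : v ∉ S) (W' : Finset V)
    (hW : ∀ t ∈ W, t ∉ W' → G.Adj v t)
    (hcard : ((G.neighborFinset v ∩ S).image f).card + ∑ t ∈ G.neighborFinset v \ W',
      (if t ∈ W then max 1 ((G.neighborFinset t ∩ S).card / 2) else 1) < c) :
    ∃ g : V → Fin c, (∀ x, x ≠ v → g x = f x) ∧ IsPartialPCF G (insert v S) g W' := by
  obtain ⟨a, ha⟩ : ∃ a, a ∉ (G.neighborFinset v ∩ S).image f ∪
      (G.neighborFinset v \ W').biUnion (blockedColors G S f) := by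
    by_contra! hcon
    have h1 : (Finset.univ : Finset (Fin c)).card ≤ _ := Finset.card_le_card fun a _ => hcon a
    rw [Finset.card_univ, Fintype.card_fin] at h1
    have h2 := h1.trans ((Finset.card_union_le _ _).trans
      (Nat.add_le_add_left Finset.card_biUnion_le _))
    refine absurd hcard (not_lt.2 (h2.trans (Nat.add_le_add_left (Finset.sum_le_sum ?_) _)))
    intro t _
    split_ifs with htW
    · exact card_blockedColors_le S f t
    · exact card_blockedColors_le_one (h.unique t htW)
  simp only [Finset.mem_union, not_or, Finset.mem_image, Finset.mem_biUnion, not_exists,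
    not_and] at ha
  refine ⟨Function.update f v a, fun x hx => Function.update_of_ne hx _ _,
    h.proper.update hv fun u hu hvu => ha.1 u (by simp [hu, hvu]), fun t ht hex => ?_⟩
  by_cases hvt : G.Adj v t
  · exact hasUniqueColor_update hv hvt.symm (ha.2 t (by simp [hvt, ht]))
  · have htW : t ∉ W := fun h => hvt (hW t h ht)
    have hne : ∀ u, G.Adj t u → u ≠ v := by rintro u htu rfl; exact hvt htu.symm
    obtain ⟨u, hu, htu⟩ := hex
    refine hasUniqueColor_congr (S := S) (f := f) (fun u htu => by simp [hne u htu])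
      (fun u _ htu => Function.update_of_ne (hne u htu) _ _)
      (h.unique t htW ⟨u, by simpa [hne u htu] using hu, htu⟩)

/-- Color one more vertex `v`, all of whose neighbors to be settled block at most one color. -/
theorem IsPartialPCF.exists_insert_of_card (h : IsPartialPCF G S f W) (hv : v ∉ S)
    (W' : Finset V) (hW : ∀ t ∈ W, t ∉ W' → G.Adj v t ∧ (G.neighborFinset t ∩ S).card ≤ 3)
    (hcard : ((G.neighborFinset v ∩ S).image f).card + (G.neighborFinset v \ W').card < c) :
    ∃ g : V → Fin c, (∀ x, x ≠ v → g x = f x) ∧ IsPartialPCF G (insert v S) g W' := by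
  refine h.exists_insert hv W' (fun t ht ht' => (hW t ht ht').1) ?_
  refine lt_of_le_of_lt (Nat.add_le_add_left ?_ _) hcard
  rw [Finset.card_eq_sum_ones]
  refine Finset.sum_le_sum fun t ht => ?_
  split_ifs with htW
  · have := (hW t htW (Finset.mem_sdiff.1 ht).2).2
    omega
  · exact le_rfl

/-- A partial coloring whose uncolored vertices form an independent set of vertices of degree two
extends to the whole graph. -/
theorem IsPartialPCF.exists_univ (hc : 5 ≤ c) (h : IsPartialPCF G S f W)
    (h2 : ∀ u ∉ S, G.degree u = 2) (hS : ∀ u ∉ S, ∀ x, G.Adj u x → x ∈ S)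
    (hW : ∀ t ∈ W, G.degree t + 1 ≤ c ∧ ∃ u ∉ S, G.Adj t u)
    (hWW : ∀ u ∉ S, ∀ p ∈ W, ∀ q ∈ W, p ≠ q → G.Adj u p → G.Adj u q → G.degree p ≤ 4) :
    ∃ g : V → Fin c, IsPartialPCF G Finset.univ g ∅ := by
  induction hn : (Finset.univ \ S).card using Nat.strong_induction_on generalizing S f W with
  | _ n ih =>
  by_cases hall : ∀ u, u ∈ S
  · obtain rfl : S = Finset.univ := by ext; simp [hall]
    refine ⟨f, h.of_unique fun t ht => ?_⟩
    obtain ⟨u, hu, -⟩ := (hW t ht).2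
    exact absurd (Finset.mem_univ u) hu
  push Not at hall
  obtain ⟨u, hu⟩ := hall
  obtain ⟨p, q, hpq, hN⟩ := Finset.card_eq_two.1 (h2 u hu)
  have hup : G.Adj u p := by rw [← mem_neighborFinset, hN]; simp
  have huq : G.Adj u q := by rw [← mem_neighborFinset, hN]; simp
  have hbound : ∀ t ∈ W, G.Adj u t →
      max 1 ((G.neighborFinset t ∩ S).card / 2) ≤ max 1 ((G.degree t - 1) / 2) := by
    intro t _ hut
    refine max_le_max le_rfl (Nat.div_le_div_right ?_)
    have hsub : G.neighborFinset t ∩ S ⊆ (G.neighborFinset t).erase u := by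
      intro x hx
      simp at hx ⊢
      exact ⟨by rintro rfl; exact hu hx.2, hx.1⟩
    have := Finset.card_le_card hsub
    rwa [Finset.card_erase_of_mem (by simpa using hut.symm), card_neighborFinset_eq_degree] at this
  obtain ⟨g, -, hg⟩ := h.exists_insert hu (W \ G.neighborFinset u)
    (fun t ht ht' => by simp [ht] at ht'; exact ht') (by
      have h1 : ((G.neighborFinset u ∩ S).image f).card ≤ 2 :=
        Finset.card_image_le.trans ((Finset.card_le_card Finset.inter_subset_left).trans
          (h2 u hu).le)
      have h3 : ∑ t ∈ G.neighborFinset u \ (W \ G.neighborFinset u),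
          (if t ∈ W then max 1 ((G.neighborFinset t ∩ S).card / 2) else 1) ≤
          ∑ t ∈ ({p, q} : Finset V),
          (if t ∈ W then max 1 ((G.neighborFinset t ∩ S).card / 2) else 1) :=
        Finset.sum_le_sum_of_subset (hN ▸ Finset.sdiff_subset)
      rw [Finset.sum_pair hpq] at h3
      have hp := hbound p
      have hq := hbound q
      have hp' := hW p
      have hq' := hW q
      have hpq4 := fun hp hq => hWW u hu p hp q hq hpq hup huq
      have hqp4 := fun hp hq => hWW u hu q hq p hp hpq.symm huq hup
      split_ifs at h3 with hpW hqW hqW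
      · have := hp hpW hup
        have := hq hqW huq
        have := hpq4 hpW hqW
        have := hqp4 hpW hqW
        omega
      · have := hp hpW hup
        have := (hp' hpW).1
        omega
      · have := hq hqW huq
        have := (hq' hqW).1
        omega
      · omega)
  refine ih (Finset.univ \ insert u S).card ?_ hg ?_ ?_ ?_ ?_ rfl
  · rw [← hn]
    refine Finset.card_lt_card ?_
    rw [Finset.ssubset_iff]
    refine ⟨u, by simp, ?_⟩
    intro x hx
    simp at hx ⊢
    rcases hx with rfl | hx
    · exact hu
    · exact hx.2
  · intro x hx
    exact h2 x (by simp at hx; tauto)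
  · intro x hx y hxy
    exact Finset.mem_insert_of_mem (hS x (by simp at hx; tauto) y hxy)
  · intro t ht
    simp at ht
    obtain ⟨hd, x, hx, htx⟩ := hW t ht.1
    refine ⟨hd, x, ?_, htx⟩
    simp only [Finset.mem_insert, not_or]
    exact ⟨by rintro rfl; exact ht.2 htx.symm, hx⟩
  · intro x hx p hp q hq
    simp at hx hp hq
    exact hWW x (by tauto) p hp.1 q hq.1

end PartialColoring

section Reducible

variable {V : Type*} [Fintype V] {c : ℕ} (G : SimpleGraph V)

/-- `G` has no PCF `c`-coloring, but all its proper induced subgraphs have one. -/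
structure IsMinimalBad [DecidableEq V] (c : ℕ) : Prop where
  exists_compl : ∀ R : Finset V, R.Nonempty → ∃ f : V → Fin c, IsPartialPCF G Rᶜ f R
  not_exists : ¬ ∃ f : V → Fin c, IsPartialPCF G Finset.univ f ∅

variable [DecidableRel G.Adj]

/-- The neighbors of degree two. -/
def twoNeighbors (v : V) : Finset V := (G.neighborFinset v).filter fun u => G.degree u = 2

/-- The neighbors of degree other than two. -/
def bigNeighbors (v : V) : Finset V := (G.neighborFinset v).filter fun u => G.degree u ≠ 2

variable {G} {R W : Finset V} {f : V → Fin c} {u v y : V}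

@[simp]
theorem mem_twoNeighbors : u ∈ twoNeighbors G v ↔ G.Adj v u ∧ G.degree u = 2 := by
  simp [twoNeighbors]

@[simp]
theorem mem_bigNeighbors : u ∈ bigNeighbors G v ↔ G.Adj v u ∧ G.degree u ≠ 2 := by
  simp [bigNeighbors]

theorem card_twoNeighbors_add (v : V) :
    (twoNeighbors G v).card + (bigNeighbors G v).card = G.degree v :=
  Finset.card_filter_add_card_filter_not _

variable [DecidableEq V]

/-- Color one vertex of the uncolored set; `X` are uncolored neighbors, `Y` are neighbors which
need not be settled. -/
theorem IsPartialPCF.exists_step (h : IsPartialPCF G (insert v R)ᶜ f W) (hv : v ∉ R)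
    (W' X Y : Finset V) (hW : ∀ t ∈ W, t ∉ W' → G.Adj v t ∧ G.degree t ≤ 3)
    (hX : ∀ x ∈ X, G.Adj v x ∧ x ∈ R) (hY : ∀ x ∈ Y, G.Adj v x ∧ x ∈ W')
    (hcard : 2 * G.degree v < c + X.card + Y.card) :
    ∃ g : V → Fin c, (∀ x, x ≠ v → g x = f x) ∧ IsPartialPCF G Rᶜ g W' := by
  have hR : Rᶜ = insert v (insert v R)ᶜ := by
    ext x
    by_cases hx : x = v <;> simp [hx, hv]
  rw [hR]
  refine h.exists_insert_of_card (by simp) W' (fun t ht ht' => ⟨(hW t ht ht').1, ?_⟩) ?_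
  · exact (Finset.card_le_card Finset.inter_subset_left).trans (hW t ht ht').2
  · have h1 : ((G.neighborFinset v ∩ (insert v R)ᶜ) ∪ X).card ≤ G.degree v := by
      refine Finset.card_le_card fun x hx => ?_
      simp only [Finset.mem_union, Finset.mem_inter] at hx
      exact hx.elim And.left fun hx => by simpa using (hX x hx).1
    have h2 : ((G.neighborFinset v \ W') ∪ Y).card ≤ G.degree v := by
      refine Finset.card_le_card fun x hx => ?_
      simp only [Finset.mem_union, Finset.mem_sdiff] at hx
      exact hx.elim And.left fun hx => by simpa using (hY x hx).1
    rw [Finset.card_union_of_disjoint] at h1 h2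
    · have := Finset.card_image_le (s := G.neighborFinset v ∩ (insert v R)ᶜ) (f := f)
      omega
    · exact Finset.disjoint_left.2 fun x hx hxY => (Finset.mem_sdiff.1 hx).2 (hY x hxY).2
    · exact Finset.disjoint_left.2 fun x hx hxX => by simp [(hX x hxX).2] at hx

namespace IsMinimalBad

theorem two_le_degree (hm : IsMinimalBad G c) (hc : 5 ≤ c) (v : V) : 2 ≤ G.degree v := by
  by_contra! hd
  obtain ⟨f, hf⟩ := hm.exists_compl {v} (by simp)
  have hf' : IsPartialPCF G (insert v ∅)ᶜ f ∅ := hf.of_unique fun t ht _ hex => by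
    obtain rfl := Finset.mem_singleton.1 ht
    exact hasUniqueColor_of_card_le_one
      ((Finset.card_le_card Finset.inter_subset_left).trans (Nat.lt_succ_iff.1 hd)) hex
  obtain ⟨g, -, hg⟩ := hf'.exists_step (by simp) ∅ ∅ ∅ (by simp) (by simp) (by simp)
    (by simp; omega)
  exact hm.not_exists ⟨g, by simpa using hg⟩

theorem not_adj_of_degree_eq_two (hm : IsMinimalBad G c) (hc : 5 ≤ c) (hu : G.degree u = 2)
    {p q : V} (hp : G.Adj u p) (hq : G.Adj u q) : ¬ G.Adj p q := by
  intro hpq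
  obtain ⟨f, hf⟩ := hm.exists_compl {u} (by simp)
  have hf' : IsPartialPCF G (insert u ∅)ᶜ f ∅ := hf.of_unique fun t ht _ hex => by
    obtain rfl := Finset.mem_singleton.1 ht
    exact hasUniqueColor_of_ne (by omega) (by simp [hp.ne']) (by simp [hq.ne']) hp hq
      (hf.proper p (by simp [hp.ne']) q (by simp [hq.ne']) hpq)
  obtain ⟨g, -, hg⟩ := hf'.exists_step (by simp) ∅ ∅ ∅ (by simp) (by simp) (by simp)
    (by simp; omega)
  exact hm.not_exists ⟨g, by simpa using hg⟩

theorem degree_ne_two_of_adj (hm : IsMinimalBad G c) (hc : 5 ≤ c) (hu : G.degree u = 2)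
    (huv : G.Adj u v) : G.degree v ≠ 2 := by
  intro hv
  obtain ⟨f, hf⟩ := hm.exists_compl {u, v} (by simp)
  have key : ∀ x z, G.Adj x z → G.degree x = 2 → z ∈ ({u, v} : Finset V) →
      (G.neighborFinset x ∩ {u, v}ᶜ).card ≤ 1 := by
    intro x z hxz hx hz
    have : G.neighborFinset x ∩ {u, v}ᶜ ⊆ (G.neighborFinset x).erase z := by
      intro w hw
      rw [Finset.mem_inter, Finset.mem_compl] at hw
      exact Finset.mem_erase.2 ⟨by rintro rfl; exact hw.2 hz, hw.1⟩
    have := Finset.card_le_card this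
    rw [Finset.card_erase_of_mem (by simpa using hxz), card_neighborFinset_eq_degree, hx] at this
    exact this
  have hf' : IsPartialPCF G (insert u {v})ᶜ f ∅ := hf.of_unique fun t ht _ hex => by
    rcases Finset.mem_insert.1 ht with rfl | ht
    · exact hasUniqueColor_of_card_le_one (key t v huv hu (by simp)) hex
    · obtain rfl := Finset.mem_singleton.1 ht
      exact hasUniqueColor_of_card_le_one (key t u huv.symm hv (by simp)) hex
  obtain ⟨g, -, hg⟩ := hf'.exists_step (by simp [huv.ne]) ∅ ∅ ∅ (by simp) (by simp) (by simp)
    (by simp; omega)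
  obtain ⟨e, -, he⟩ := IsPartialPCF.exists_step (v := v) (R := ∅) hg (by simp) ∅ ∅ ∅
    (by simp) (by simp) (by simp) (by simp; omega)
  exact hm.not_exists ⟨e, by simpa using he⟩

/-- A partial coloring missing only vertices of degree two cannot exist. -/
theorem false_of_isPartialPCF (hm : IsMinimalBad G c) (hc : 5 ≤ c) (h : IsPartialPCF G Rᶜ f W)
    (hR : ∀ u ∈ R, G.degree u = 2) (hW : ∀ t ∈ W, G.degree t + 1 ≤ c ∧ ∃ u ∈ R, G.Adj t u)
    (hWW : ∀ u ∈ R, ∀ p ∈ W, ∀ q ∈ W, p ≠ q → G.Adj u p → G.Adj u q → G.degree p ≤ 4) :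
    False := by
  refine hm.not_exists (h.exists_univ hc ?_ ?_ ?_ ?_)
  · simpa using hR
  · intro u hu x hux
    rw [Finset.mem_compl, not_not] at hu
    exact Finset.mem_compl.2 fun hx => hm.degree_ne_two_of_adj hc (hR u hu) hux (hR x hx)
  · simpa using hW
  · simpa using hWW

theorem le_of_twoNeighbors (hm : IsMinimalBad G c) (hc : 5 ≤ c)
    (hk : 1 ≤ (twoNeighbors G v).card) :
    c ≤ (twoNeighbors G v).card + 2 * (bigNeighbors G v).card := by
  by_contra! hlt
  have hd := card_twoNeighbors_add (G := G) v
  obtain ⟨f, hf⟩ := hm.exists_compl (insert v (twoNeighbors G v)) (by simp)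
  obtain ⟨g, -, hg⟩ := hf.exists_step (by simp) {v} (twoNeighbors G v) ∅ (by simp; grind)
    (by simp) (by simp) (by simp; omega)
  obtain ⟨u, hu⟩ := Finset.card_pos.1 hk
  rw [mem_twoNeighbors] at hu
  refine hm.false_of_isPartialPCF hc hg (by simp) ?_ ?_
  · simp only [Finset.mem_singleton, forall_eq, mem_twoNeighbors]
    exact ⟨by omega, u, hu, hu.1⟩
  · simp only [Finset.mem_singleton]
    grind

/-- Two adjacent vertices cannot both have few big neighbors. -/
theorem false_of_adj (hm : IsMinimalBad G c) (hc : 5 ≤ c) (hvy : G.Adj v y)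
    (hkv : 1 ≤ (twoNeighbors G v).card) (hky : 1 ≤ (twoNeighbors G y).card)
    (hv : (twoNeighbors G v).card + 2 * (bigNeighbors G v).card ≤ c)
    (hy : (twoNeighbors G y).card + 2 * (bigNeighbors G y).card ≤ c + 1)
    (hv2 : G.degree v ≠ 2) (hy2 : G.degree y ≠ 2) (hdy : G.degree y + 1 ≤ c) : False := by
  have hdv := card_twoNeighbors_add (G := G) v
  have hdy' := card_twoNeighbors_add (G := G) y
  have hbv : 1 ≤ (bigNeighbors G v).card := Finset.card_pos.2 ⟨y, by simp [hvy, hy2]⟩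
  obtain ⟨f, hf⟩ := hm.exists_compl
    (insert y (insert v (twoNeighbors G v ∪ twoNeighbors G y))) (by simp)
  have hne := hvy.ne
  obtain ⟨g, -, hg⟩ := hf.exists_step (by simp [hy2, hne.symm])
    (insert v (insert y (twoNeighbors G v))) (insert v (twoNeighbors G y)) {v}
    (by simp; grind) (by simp [hvy.symm]; grind) (by simp [hvy.symm])
    (by rw [Finset.card_insert_of_notMem (by simp [hv2])]; simp; omega)
  obtain ⟨g', -, hg'⟩ := hg.exists_step (by simp [hv2]) {v, y} (twoNeighbors G v) {y}
    (by simp; grind) (by simp; grind) (by simp [hvy])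
    (by simp; omega)
  obtain ⟨u, hu⟩ := Finset.card_pos.1 hkv
  obtain ⟨w, hw⟩ := Finset.card_pos.1 hky
  rw [mem_twoNeighbors] at hu hw
  refine hm.false_of_isPartialPCF hc hg' (by simp; grind) ?_ ?_
  · simp only [Finset.mem_insert, Finset.mem_singleton, forall_eq_or_imp, forall_eq,
      Finset.mem_union, mem_twoNeighbors]
    exact ⟨⟨by omega, u, .inl hu, hu.1⟩, by omega, w, .inr hw, hw.1⟩
  · intro u hu p hp q hq hpq hup huq
    have hu2 : G.degree u = 2 := by simp at hu; grind
    have := hm.not_adj_of_degree_eq_two hc hu2 hup huq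
    have := hvy.symm
    simp only [Finset.mem_insert, Finset.mem_singleton] at hp hq
    grind

theorem false_of_adj_degree_three (hm : IsMinimalBad G c) (hc : 6 ≤ c) (hy : G.degree y = 3)
    (hyv : G.Adj y v) (hk : 1 ≤ (twoNeighbors G v).card)
    (hv : (twoNeighbors G v).card + 2 * (bigNeighbors G v).card ≤ c) :
    False := by
  have hdv := card_twoNeighbors_add (G := G) v
  have hbv : 1 ≤ (bigNeighbors G v).card := Finset.card_pos.2 ⟨y, by simp [hyv.symm, hy]⟩
  obtain ⟨f, hf⟩ := hm.exists_compl (insert v (insert y (twoNeighbors G v))) (by simp)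
  obtain ⟨g, -, hg⟩ := hf.exists_step (by simp [hyv.ne']) {v}
    (insert y (twoNeighbors G v)) ∅
    (by simp [hyv.symm]; grind) (by simp [hyv.symm]; grind) (by simp)
    (by rw [Finset.card_insert_of_notMem (by simp [hy])]; simp; omega)
  obtain ⟨g', -, hg'⟩ := hg.exists_step (by simp [hy]) {v} ∅ {v}
    (by simp) (by simp) (by simp [hyv]) (by simp; omega)
  obtain ⟨u, hu⟩ := Finset.card_pos.1 hk
  rw [mem_twoNeighbors] at hu
  refine hm.false_of_isPartialPCF (by omega) hg' (by simp) ?_ ?_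
  · simp only [Finset.mem_singleton, forall_eq, mem_twoNeighbors]
    exact ⟨by omega, u, hu, hu.1⟩
  · simp only [Finset.mem_singleton]
    grind

end IsMinimalBad

end Reducible

section Reducible

variable {V : Type*} [Fintype V] {c : ℕ} (G : SimpleGraph V) [DecidableRel G.Adj]

/-- The vertices of degree three or four that need extra charge when `c = 5`. -/
def IsLight (v : V) : Prop :=
  1 ≤ (twoNeighbors G v).card ∧ 1 ≤ (bigNeighbors G v).card ∧
    (twoNeighbors G v).card + 2 * (bigNeighbors G v).card = 5

variable {G} {f : V → Fin c} {v w y z : V}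

theorem IsLight.two_lt_degree (h : IsLight G v) : 2 < G.degree v := by
  have := card_twoNeighbors_add (G := G) v
  have := h.2
  omega

theorem IsLight.degree_le_four (h : IsLight G v) : G.degree v ≤ 4 := by
  have := card_twoNeighbors_add (G := G) v
  have := h.2
  omega

variable [DecidableEq V]

namespace IsMinimalBad

theorem lt_two_mul_degree (hm : IsMinimalBad G c) (hc : 7 ≤ c) (hy : G.degree y = 3)
    (hyv : G.Adj y v) : c < 2 * G.degree v := by
  by_contra! hlt
  obtain ⟨f, hf⟩ := hm.exists_compl (insert v {y}) (by simp)
  obtain ⟨g, -, hg⟩ := hf.exists_step (by simp [hyv.ne']) {v} {y} ∅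
    (by simp [hyv.symm]; grind) (by simp [hyv.symm]) (by simp) (by simp; omega)
  obtain ⟨g', -, hg'⟩ := hg.exists_insert (v := y) (by simp) ∅ (by simp [hyv]) (by
    have h1 : ((G.neighborFinset y ∩ {y}ᶜ).image g).card ≤ 3 :=
      Finset.card_image_le.trans ((Finset.card_le_card Finset.inter_subset_left).trans hy.le)
    rw [Finset.sdiff_empty, ← Finset.add_sum_erase _ _ ((mem_neighborFinset _ _ _).2 hyv),
      Finset.sum_congr rfl fun t ht => if_neg (by simpa using Finset.ne_of_mem_erase ht)]
    have h2 : ((G.neighborFinset y).erase v).card = 2 := by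
      rw [Finset.card_erase_of_mem (by simpa using hyv), card_neighborFinset_eq_degree, hy]
    have h3 : (G.neighborFinset v ∩ {y}ᶜ).card ≤ G.degree v :=
      Finset.card_le_card Finset.inter_subset_left
    simp [h2]
    omega)
  have huniv : insert y ({y}ᶜ : Finset V) = Finset.univ := by simp
  exact hm.not_exists ⟨g', huniv ▸ hg'⟩

theorem false_of_adj_three_three_of_ne (hm : IsMinimalBad G c) (hc : 6 ≤ c)
    (hv : G.degree v = 3) (hy : G.degree y = 3) (hvy : G.Adj v y)
    (hf : IsPartialPCF G {v, y}ᶜ f {v, y}) {a b : V} (ha : G.Adj v a) (hb : G.Adj v b)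
    (hay : a ≠ y) (hby : b ≠ y) (hab : f a ≠ f b) : False := by
  obtain ⟨g, hgf, hg⟩ := hf.exists_step (by simp [hvy.ne]) {v} {y} ∅
    (by simp [hvy]; grind) (by simp [hvy]) (by simp) (by simp; omega)
  obtain ⟨g', hgg, hg'⟩ := IsPartialPCF.exists_step (R := ∅) hg (by simp) {v} ∅ {v}
    (by simp) (by simp) (by simp [hvy.symm]) (by simp; omega)
  refine hm.not_exists ⟨g', ?_⟩
  rw [Finset.compl_empty] at hg'
  refine hg'.of_unique fun t ht _ _ => ?_
  obtain rfl := Finset.mem_singleton.1 ht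
  refine hasUniqueColor_of_ne hv.le (Finset.mem_univ _) (Finset.mem_univ _) ha hb ?_
  rwa [hgg a hay, hgg b hby, hgf a ha.ne', hgf b hb.ne']

theorem not_adj_of_degree_eq_three (hm : IsMinimalBad G c) (hc : 6 ≤ c)
    (hv : G.degree v = 3) (hy : G.degree y = 3) : ¬ G.Adj v y := by
  intro hvy
  obtain ⟨f, hf⟩ := hm.exists_compl {v, y} (by simp)
  have hev : ((G.neighborFinset v ∩ {v, y}ᶜ).image f).card ≤ 1 := by
    rw [Finset.card_le_one]
    simp only [Finset.mem_image, Finset.mem_inter, mem_neighborFinset, Finset.mem_compl,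
      Finset.mem_insert, Finset.mem_singleton, not_or]
    rintro _ ⟨a, ha, rfl⟩ _ ⟨b, hb, rfl⟩
    by_contra hab
    exact hm.false_of_adj_three_three_of_ne hc hv hy hvy hf ha.1 hb.1 ha.2.2 hb.2.2 hab
  have hey : ((G.neighborFinset y ∩ {v, y}ᶜ).image f).card ≤ 1 := by
    rw [Finset.card_le_one]
    simp only [Finset.mem_image, Finset.mem_inter, mem_neighborFinset, Finset.mem_compl,
      Finset.mem_insert, Finset.mem_singleton, not_or]
    rintro _ ⟨a, ha, rfl⟩ _ ⟨b, hb, rfl⟩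
    by_contra hab
    rw [Finset.pair_comm] at hf
    exact hm.false_of_adj_three_three_of_ne hc hy hv hvy.symm hf ha.1 hb.1 ha.2.1 hb.2.1 hab
  have hle (x : V) (S : Finset V) : (G.neighborFinset x ∩ S).card ≤ G.degree x :=
    Finset.card_le_card Finset.inter_subset_left
  have hle' (x : V) (S : Finset V) : (G.neighborFinset x \ S).card ≤ G.degree x :=
    Finset.card_le_card Finset.sdiff_subset
  obtain ⟨g, hgf, hg⟩ := hf.exists_insert_of_card (v := v) (by simp) {v} (by
    intro t ht ht'
    obtain rfl : t = y := by simp at ht ht'; tauto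
    exact ⟨hvy, (hle t _).trans hy.le⟩) (by have := hle' v {v}; omega)
  have hS : insert v ({v, y}ᶜ : Finset V) = {y}ᶜ := by
    ext x
    have := hvy.ne
    simp
    grind
  rw [hS] at hg
  obtain ⟨g', -, hg'⟩ := hg.exists_insert_of_card (v := y) (by simp) ∅
    (by have := hle v {y}ᶜ; simp [hvy.symm]; omega) (by
      have hsub : (G.neighborFinset y ∩ {y}ᶜ).image g ⊆
          insert (g v) ((G.neighborFinset y ∩ {v, y}ᶜ).image f) := by
        intro a ha
        obtain ⟨x, hx, rfl⟩ := Finset.mem_image.1 ha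
        by_cases hxv : x = v
        · simp [hxv]
        · refine Finset.mem_insert_of_mem (Finset.mem_image.2 ⟨x, ?_, (hgf x hxv).symm⟩)
          simp at hx ⊢
          exact ⟨hx.1, hxv, hx.2⟩
      have h1 := (Finset.card_le_card hsub).trans (Finset.card_insert_le _ _)
      have := hle' y ∅
      omega)
  have huniv : insert y ({y}ᶜ : Finset V) = Finset.univ := by simp
  exact hm.not_exists ⟨g', huniv ▸ hg'⟩

theorem eq_of_isLight (hm : IsMinimalBad G 5) (hy : G.degree y = 3) (hv : IsLight G v)
    (hw : IsLight G w) (hyv : G.Adj y v) (hyw : G.Adj y w) : v = w := by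
  by_contra hne
  have hdv := card_twoNeighbors_add (G := G) v
  have hdw := card_twoNeighbors_add (G := G) w
  have h2v := hv.two_lt_degree
  have h2w := hw.two_lt_degree
  obtain ⟨hkv, hmv, hv5⟩ := id hv
  obtain ⟨hkw, hmw, hw5⟩ := id hw
  obtain ⟨f, hf⟩ := hm.exists_compl
    (insert w (insert v (insert y (twoNeighbors G v ∪ twoNeighbors G w)))) (by simp)
  obtain ⟨g, -, hg⟩ := hf.exists_step (by simp [h2w.ne', hyw.ne', Ne.symm hne])
    (insert v (insert w (twoNeighbors G v))) (insert y (twoNeighbors G w)) ∅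
    (by simp [hyw.symm]; grind) (by simp [hyw.symm]; grind) (by simp)
    (by rw [Finset.card_insert_of_notMem (by simp [hy])]; simp; omega)
  obtain ⟨g', -, hg'⟩ := hg.exists_step (by simp [h2v.ne', hyv.ne'])
    {v, w} (insert y (twoNeighbors G v)) ∅
    (by simp; grind) (by simp [hyv.symm]; grind) (by simp)
    (by rw [Finset.card_insert_of_notMem (by simp [hy])]; simp; omega)
  obtain ⟨g'', -, hg''⟩ := hg'.exists_step (by simp [hy]) {v, w} ∅ {v, w}
    (by simp) (by simp) (by simp [hyv, hyw]) (by simp [hne, hy])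
  obtain ⟨u, hu⟩ := Finset.card_pos.1 hkv
  obtain ⟨z, hz⟩ := Finset.card_pos.1 hkw
  rw [mem_twoNeighbors] at hu hz
  refine hm.false_of_isPartialPCF le_rfl hg'' (by simp; grind) ?_ ?_
  · simp only [Finset.mem_insert, Finset.mem_singleton, forall_eq_or_imp, forall_eq,
      Finset.mem_union, mem_twoNeighbors]
    exact ⟨⟨by omega, u, .inl hu, hu.1⟩, by omega, z, .inr hz, hz.1⟩
  · intro u _ p hp _ _ _ _ _
    simp only [Finset.mem_insert, Finset.mem_singleton] at hp
    rcases hp with rfl | rfl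
    exacts [hv.degree_le_four, hw.degree_le_four]

theorem false_of_isLight (hm : IsMinimalBad G 5) (hv : IsLight G v) (hw : IsLight G w)
    (hy : G.degree y = 3) (hz : G.degree z = 3) (hy2 : ∀ x, G.Adj y x → G.degree x ≠ 2)
    (hz2 : twoNeighbors G z = ∅)
    (hyv : G.Adj y v) (hyz : G.Adj y z) (hzw : G.Adj z w) (hyw : ¬ G.Adj y w) : False := by
  have hdv := card_twoNeighbors_add (G := G) v
  have hdw := card_twoNeighbors_add (G := G) w
  have h2v := hv.two_lt_degree
  have h2w := hw.two_lt_degree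
  obtain ⟨hkv, hmv, hv5⟩ := id hv
  obtain ⟨hkw, hmw, hw5⟩ := id hw
  have hvw : v ≠ w := by rintro rfl; exact hyw hyv
  have hvz : v ≠ z := by rintro rfl; simp [hz2] at hkv
  have hwy : w ≠ y := by rintro rfl; obtain ⟨x, hx⟩ := Finset.card_pos.1 hkw; simp at hx; grind
  obtain ⟨x, hx⟩ : (G.neighborFinset y \ {v, z}).Nonempty := by
    rw [← Finset.card_pos]
    have h1 := Finset.le_card_sdiff {v, z} (G.neighborFinset y)
    rw [card_neighborFinset_eq_degree, hy, Finset.card_pair hvz] at h1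
    omega
  simp only [Finset.mem_sdiff, mem_neighborFinset, Finset.mem_insert, Finset.mem_singleton,
    not_or] at hx
  obtain ⟨hyx, hxv, hxz⟩ := hx
  have hN : G.neighborFinset y = {v, z, x} := by
    symm
    refine Finset.eq_of_subset_of_card_le ?_ ?_
    · simp [Finset.insert_subset_iff, hyv, hyz, hyx]
    · rw [card_neighborFinset_eq_degree, hy, Finset.card_eq_three.2 ⟨v, z, x, hvz, Ne.symm hxv,
        Ne.symm hxz, rfl⟩]
  have hx2 := hy2 x hyx
  have hxw : x ≠ w := by rintro rfl; exact hyw hyx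
  obtain ⟨f, hf⟩ := hm.exists_compl
    (insert v (insert w (insert y (insert z (twoNeighbors G v ∪ twoNeighbors G w))))) (by simp)
  obtain ⟨g, -, hg⟩ := hf.exists_step (by simp [h2v.ne', hyv.ne', hvw, hvz])
    (insert v (insert w (insert z (twoNeighbors G w)))) (insert y (twoNeighbors G v)) ∅
    (by simp [hyv.symm]; grind) (by simp [hyv.symm]; grind) (by simp)
    (by rw [Finset.card_insert_of_notMem (by simp [hy])]; simp; omega)
  have hgvx : g v ≠ g x := by
    intro hvx
    obtain ⟨q, hq, hyq, huniq⟩ := hg.unique y (by simp [hyv.ne, Ne.symm hwy, hyz.ne, hy])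
      ⟨v, by simp [h2v.ne', hyv.ne', hvw, hvz], hyv⟩
    have hqN : q ∈ ({v, z, x} : Finset V) := hN ▸ (mem_neighborFinset _ _ _).2 hyq
    simp only [Finset.mem_insert, Finset.mem_singleton] at hqN
    rcases hqN with rfl | rfl | rfl
    · exact hxv (huniq x (by simp [hx2, hxw, hyx.ne', hxz]) hyx hvx.symm)
    · simp at hq
    · exact hxv (huniq v (by simp [h2v.ne', hyv.ne', hvw, hvz]) hyv hvx).symm
  obtain ⟨g₁, hgg₁, hg₁⟩ := hg.exists_step (by simp [h2w.ne', hwy, hzw.ne'])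
    {v, w} (insert z (twoNeighbors G w)) ∅
    (by simp [hzw.symm]; grind) (by simp [hzw.symm]; grind) (by simp)
    (by rw [Finset.card_insert_of_notMem (by simp [hz])]; simp; omega)
  obtain ⟨g₂, hgg₂, hg₂⟩ := hg₁.exists_step (by simp [hy, hyz.ne])
    {v, w} {z} {v} (by simp) (by simp [hyz]) (by simp [hyv]) (by simp [hy])
  obtain ⟨g₃, hgg₃, hg₃⟩ := hg₂.exists_step (by simp [hz])
    {v, w, y} ∅ {w, y} (by simp) (by simp) (by simp [hyz.symm, hzw])
    (by simp [hz, hwy])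
  have hg₄ := hg₃.of_unique (W' := {v, w}) fun t ht ht' _ => by
    obtain rfl : t = y := by simp at ht ht'; tauto
    refine hasUniqueColor_of_ne hy.le (by simp [h2v.ne']) (by simp [hx2]) hyv hyx ?_
    rwa [hgg₃ v hvz, hgg₃ x hxz, hgg₂ v hyv.ne', hgg₂ x hyx.ne', hgg₁ v hvw, hgg₁ x hxw]
  obtain ⟨u, hu⟩ := Finset.card_pos.1 hkv
  obtain ⟨r, hr⟩ := Finset.card_pos.1 hkw
  rw [mem_twoNeighbors] at hu hr
  refine hm.false_of_isPartialPCF le_rfl hg₄ (by simp; grind) ?_ ?_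
  · simp only [Finset.mem_insert, Finset.mem_singleton, forall_eq_or_imp, forall_eq,
      Finset.mem_union, mem_twoNeighbors]
    exact ⟨⟨by omega, u, .inl hu, hu.1⟩, by omega, r, .inr hr, hr.1⟩
  · intro u _ p hp _ _ _ _ _
    simp only [Finset.mem_insert, Finset.mem_singleton] at hp
    rcases hp with rfl | rfl
    exacts [hv.degree_le_four, hw.degree_le_four]

end IsMinimalBad

end Reducible

section Discharging

variable {V : Type*} [Fintype V] {c : ℕ} {G : SimpleGraph V} [DecidableRel G.Adj] {v : V}

/-- If moving charge along the edges makes all charges nonnegative although the total charge is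
not positive, then all charges become zero. -/
theorem charge_eq_zero (D : V → ℤ) (ψ : V → V → ℤ) (hD : ∑ v, D v ≤ 0)
    (hF : ∀ v, 0 ≤ D v + ∑ u ∈ G.neighborFinset v, (ψ u v - ψ v u)) (v : V) :
    D v + ∑ u ∈ G.neighborFinset v, (ψ u v - ψ v u) = 0 := by
  have hzero : ∑ v, ∑ u ∈ G.neighborFinset v, (ψ u v - ψ v u) = 0 := by
    simp only [Finset.sum_sub_distrib]
    rw [sub_eq_zero]
    exact Finset.sum_comm' (by simp [G.adj_comm])
  have hsum : ∑ v, (D v + ∑ u ∈ G.neighborFinset v, (ψ u v - ψ v u)) = 0 := by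
    refine le_antisymm ?_ (Finset.sum_nonneg fun v _ => hF v)
    rw [Finset.sum_add_distrib, hzero, add_zero]
    exact hD
  exact (Finset.sum_eq_zero_iff_of_nonneg fun v _ => hF v).1 hsum v (Finset.mem_univ v)

theorem sum_neighborFinset (φ : V → ℤ) (v : V) : ∑ u ∈ G.neighborFinset v, φ u =
    ∑ u ∈ twoNeighbors G v, φ u + ∑ u ∈ bigNeighbors G v, φ u :=
  (Finset.sum_filter_add_sum_filter_not _ _ _).symm

theorem sum_charge_nonpos (hE : (c + 2) * ∑ v, G.degree v ≤ 4 * c * Fintype.card V) :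
    ∑ v, ((G.degree v : ℤ) * (c + 2) - 4 * c) ≤ 0 := by
  rw [Finset.sum_sub_distrib, ← Finset.sum_mul, Finset.sum_const, Finset.card_univ, nsmul_eq_mul]
  have : (((c + 2) * ∑ v, G.degree v : ℕ) : ℤ) ≤ (4 * c * Fintype.card V : ℕ) := by
    exact_mod_cast hE
  push_cast at this
  linarith

/-- The charge given by `v` to `u` when `c ≥ 6`. -/
def chargeSix (G : SimpleGraph V) [DecidableRel G.Adj] (c : ℕ) (v u : V) : ℤ :=
  if G.degree v = 2 then 0 else if G.degree u = 2 then c - 2 else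
    if G.degree u = 3 ∧ 4 ≤ G.degree v then c - 6 else 0

variable [DecidableEq V]

theorem IsMinimalBad.charge_six_of_four_le (hm : IsMinimalBad G c) (hc : 6 ≤ c)
    (hv : 4 ≤ G.degree v) (F : ℤ) (hF : F = (G.degree v : ℤ) * (c + 2) - 4 * c +
      ∑ u ∈ G.neighborFinset v, (chargeSix G c u v - chargeSix G c v u)) :
    0 ≤ F ∧ (F = 0 → (G.degree v = c ∧ bigNeighbors G v = ∅) ∨
      (G.degree v < c ∧ 1 ≤ (twoNeighbors G v).card ∧ 1 ≤ (bigNeighbors G v).card ∧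
        (twoNeighbors G v).card + 2 * (bigNeighbors G v).card = c ∧
        ∀ u, G.Adj v u → G.degree u ≠ 3)) := by
  have hd := card_twoNeighbors_add (G := G) v
  have hc' : (6 : ℤ) ≤ c := by exact_mod_cast hc
  rw [sum_neighborFinset] at hF
  have h2 : ∑ u ∈ twoNeighbors G v, (chargeSix G c u v - chargeSix G c v u) =
      -((twoNeighbors G v).card * (c - 2)) := by
    rw [Finset.sum_congr rfl (g := fun _ => -((c : ℤ) - 2)), Finset.sum_const, nsmul_eq_mul]
    · ring
    · intro u hu
      rw [mem_twoNeighbors] at hu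
      simp [chargeSix, hu.2, show G.degree v ≠ 2 by omega]
  have hval : ∀ u ∈ bigNeighbors G v, chargeSix G c u v - chargeSix G c v u =
      if G.degree u = 3 then -((c : ℤ) - 6) else 0 := by
    intro u hu
    rw [mem_bigNeighbors] at hu
    simp only [chargeSix, hu.2, show G.degree v ≠ 2 by omega, show G.degree v ≠ 3 by omega, hv]
    split_ifs <;> simp_all
  rw [h2, Finset.sum_congr rfl hval] at hF
  have hB : -((bigNeighbors G v).card * ((c : ℤ) - 6)) ≤
      ∑ u ∈ bigNeighbors G v, if G.degree u = 3 then -((c : ℤ) - 6) else 0 := by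
    rw [← mul_neg, ← nsmul_eq_mul]
    refine Finset.card_nsmul_le_sum _ _ _ fun u _ => ?_
    split_ifs <;> omega
  have hB0 : (∀ u, G.Adj v u → G.degree u ≠ 3) →
      ∑ u ∈ bigNeighbors G v, (if G.degree u = 3 then -((c : ℤ) - 6) else 0) = 0 := by
    intro h3
    refine Finset.sum_eq_zero fun u hu => if_neg (h3 u (mem_bigNeighbors.1 hu).1)
  have hA := hm.le_of_twoNeighbors (by omega) (v := v)
  have hC : ∀ u, G.Adj v u → G.degree u = 3 → 1 ≤ (twoNeighbors G v).card →
      c < (twoNeighbors G v).card + 2 * (bigNeighbors G v).card := by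
    intro u hvu hu hk
    by_contra! hle
    exact hm.false_of_adj_degree_three hc hu hvu.symm hk hle
  have hC0 : ∀ u, G.Adj v u → G.degree u = 3 → c < 2 * G.degree v := by
    intro u hvu hu
    rcases hc.eq_or_lt with rfl | hc
    · omega
    · exact hm.lt_two_mul_degree hc hu hvu.symm
  rw [← Finset.card_eq_zero]
  generalize ∑ u ∈ bigNeighbors G v, (if G.degree u = 3 then -((c : ℤ) - 6) else 0) = B at *
  rw [← hd] at hv hF hC0 ⊢
  generalize (twoNeighbors G v).card = k at *
  generalize (bigNeighbors G v).card = m at *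
  push_cast at hF
  have hF1 : 4 * (k : ℤ) + 8 * m - 4 * c ≤ F := by rw [hF]; linarith
  have hF0 : B = 0 → F = 4 * (k : ℤ) + 8 * m - 4 * c + (c - 6) * m := by
    intro hB; rw [hF, hB]; ring
  have hcm : 0 ≤ ((c : ℤ) - 6) * m := by
    have : (0 : ℤ) ≤ m := by positivity
    exact mul_nonneg (by omega) this
  by_cases hdc : c ≤ k + m
  · refine ⟨by omega, fun h0 => .inl ⟨by omega, by omega⟩⟩
  by_cases hk : 1 ≤ k
  · have := hA hk
    refine ⟨by omega, fun h0 => .inr ⟨by omega, hk, by omega, by omega, fun u hvu hu => ?_⟩⟩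
    have := hC u hvu hu hk
    omega
  · by_cases h3 : ∀ u, G.Adj v u → G.degree u ≠ 3
    · have h := hF0 (hB0 h3)
      obtain rfl : k = 0 := by omega
      have : 0 < F := by
        have : ((c : ℤ) - 6) * 4 ≤ (c - 6) * m := mul_le_mul_of_nonneg_left (by omega) (by omega)
        push_cast at h
        omega
      exact ⟨this.le, fun h0 => absurd h0 this.ne'⟩
    · push Not at h3
      obtain ⟨u, hvu, hu⟩ := h3
      have := hC0 u hvu hu
      exact ⟨by omega, fun h0 => by omega⟩

theorem IsMinimalBad.four_le_degree_of_adj (hm : IsMinimalBad G c) (hc : 6 ≤ c)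
    (hv : G.degree v = 3) {u : V} (hvu : G.Adj v u) : 4 ≤ G.degree u := by
  have hd := card_twoNeighbors_add (G := G) v
  have h1 := hm.two_le_degree (by omega) u
  have h2 : G.degree u ≠ 2 := by
    intro hu
    have hk : 1 ≤ (twoNeighbors G v).card := Finset.card_pos.2 ⟨u, by simp [hvu, hu]⟩
    have := hm.le_of_twoNeighbors (by omega) hk
    omega
  have h3 : G.degree u ≠ 3 := fun hu => hm.not_adj_of_degree_eq_three hc hv hu hvu
  omega

theorem IsMinimalBad.charge_six_of_eq_three (hm : IsMinimalBad G c) (hc : 6 ≤ c)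
    (hv : G.degree v = 3) : 0 ≤ (G.degree v : ℤ) * (c + 2) - 4 * c +
      ∑ u ∈ G.neighborFinset v, (chargeSix G c u v - chargeSix G c v u) := by
  rw [Finset.sum_congr rfl (g := fun _ => (c : ℤ) - 6), Finset.sum_const, nsmul_eq_mul,
    card_neighborFinset_eq_degree, hv]
  · push_cast
    omega
  · intro u hu
    have := hm.four_le_degree_of_adj hc hv ((mem_neighborFinset _ _ _).1 hu)
    simp [chargeSix, hv, this, show G.degree u ≠ 2 by omega, show G.degree u ≠ 3 by omega]

theorem IsMinimalBad.charge_six_of_eq_two (hm : IsMinimalBad G c) (hc : 6 ≤ c)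
    (hv : G.degree v = 2) : (G.degree v : ℤ) * (c + 2) - 4 * c +
      ∑ u ∈ G.neighborFinset v, (chargeSix G c u v - chargeSix G c v u) = 0 := by
  rw [Finset.sum_congr rfl (g := fun _ => (c : ℤ) - 2), Finset.sum_const, nsmul_eq_mul,
    card_neighborFinset_eq_degree, hv]
  · push_cast
    ring
  · intro u hu
    have := hm.degree_ne_two_of_adj (by omega) hv ((mem_neighborFinset _ _ _).1 hu)
    simp [chargeSix, hv, this]

theorem IsMinimalBad.structure_of_six_le (hm : IsMinimalBad G c) (hc : 6 ≤ c)
    (hE : (c + 2) * ∑ v, G.degree v ≤ 4 * c * Fintype.card V) (v : V) :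
    G.degree v = 2 ∨ (G.degree v = c ∧ bigNeighbors G v = ∅) := by
  have hz := charge_eq_zero (G := G) _ (chargeSix G c) (sum_charge_nonpos hE) (by
    intro v
    have := hm.two_le_degree (by omega) v
    by_cases h2 : G.degree v = 2
    · exact (hm.charge_six_of_eq_two hc h2).ge
    by_cases h3 : G.degree v = 3
    · exact hm.charge_six_of_eq_three hc h3
    · exact (hm.charge_six_of_four_le hc (by omega) _ rfl).1)
  have h4 := fun v hv => (hm.charge_six_of_four_le (v := v) hc hv _ rfl).2 (hz v)
  have hno3 : ∀ v, G.degree v ≠ 3 := by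
    intro v hv
    obtain ⟨y, hy⟩ : (G.neighborFinset v).Nonempty := by
      rw [← Finset.card_pos, card_neighborFinset_eq_degree]; omega
    rw [mem_neighborFinset] at hy
    rcases h4 y (hm.four_le_degree_of_adj hc hv hy) with h | h
    · have : v ∈ bigNeighbors G y := by simp [hy.symm, hv]
      simp [h.2] at this
    · exact h.2.2.2.2 v hy.symm hv
  by_cases h2 : G.degree v = 2
  · exact .inl h2
  have := hm.two_le_degree (by omega) v
  have := hno3 v
  rcases h4 v (by omega) with h | h
  · exact .inr h
  obtain ⟨y, hy⟩ := Finset.card_pos.1 h.2.2.1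
  rw [mem_bigNeighbors] at hy
  have := hm.two_le_degree (by omega) y
  have := hno3 y
  rcases h4 y (by omega) with h' | h'
  · have : v ∈ bigNeighbors G y := by simp [hy.1.symm, h2]
    simp [h'.2] at this
  · exact (hm.false_of_adj (by omega) hy.1 h.2.1 h'.2.1 h.2.2.2.1.le (by omega) h2 hy.2
      (by omega)).elim

end Discharging

section DischargingFive

variable {V : Type*} [Fintype V] {G : SimpleGraph V} [DecidableRel G.Adj] {u v : V}

open scoped Classical in
/-- The charge given by `v` to `u` when `c = 5`. -/
noncomputable def chargeFive (G : SimpleGraph V) [DecidableRel G.Adj] (v u : V) : ℤ :=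
  if G.degree v = 2 then 0 else if G.degree u = 2 then 3 else if IsLight G u then 1 else 0

theorem sum_twoNeighbors_chargeFive (hv : G.degree v ≠ 2) :
    ∑ u ∈ twoNeighbors G v, (chargeFive G u v - chargeFive G v u) =
      -3 * (twoNeighbors G v).card := by
  rw [Finset.sum_congr rfl (g := fun _ => (-3 : ℤ)), Finset.sum_const, nsmul_eq_mul]
  · ring
  · intro u hu
    rw [mem_twoNeighbors] at hu
    simp [chargeFive, hu.2, hv]

variable [DecidableEq V]

theorem IsMinimalBad.not_isLight_of_adj (hm : IsMinimalBad G 5) (hv : IsLight G v)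
    (hvu : G.Adj v u) : ¬ IsLight G u := fun hu =>
  hm.false_of_adj le_rfl hvu hv.1 hu.1 hv.2.2.le (by rw [hu.2.2]; omega) hv.two_lt_degree.ne'
    hu.two_lt_degree.ne' (by have := hu.degree_le_four; omega)

theorem IsMinimalBad.charge_five_of_isLight (hm : IsMinimalBad G 5) (hv : IsLight G v) :
    (G.degree v : ℤ) * (5 + 2) - 4 * 5 +
      ∑ u ∈ G.neighborFinset v, (chargeFive G u v - chargeFive G v u) = 0 := by
  have h2 := hv.two_lt_degree.ne'
  rw [sum_neighborFinset, sum_twoNeighbors_chargeFive h2,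
    Finset.sum_congr (s₁ := bigNeighbors G v) rfl (g := fun _ => (1 : ℤ)), Finset.sum_const,
    nsmul_eq_mul, ← card_twoNeighbors_add]
  · have := hv.2.2
    push_cast
    omega
  · intro u hu
    rw [mem_bigNeighbors] at hu
    simp [chargeFive, hu.2, h2, hv, hm.not_isLight_of_adj hv hu.1]

theorem IsMinimalBad.charge_five_of_eq_two (hm : IsMinimalBad G 5) (hv : G.degree v = 2) :
    (G.degree v : ℤ) * (5 + 2) - 4 * 5 +
      ∑ u ∈ G.neighborFinset v, (chargeFive G u v - chargeFive G v u) = 0 := by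
  rw [Finset.sum_congr rfl (g := fun _ => (3 : ℤ)), Finset.sum_const, nsmul_eq_mul,
    card_neighborFinset_eq_degree, hv]
  · norm_num
  · intro u hu
    have := hm.degree_ne_two_of_adj le_rfl hv ((mem_neighborFinset _ _ _).1 hu)
    simp [chargeFive, hv, this]

theorem IsMinimalBad.charge_five_of_not_isLight (hm : IsMinimalBad G 5) (hv2 : G.degree v ≠ 2)
    (hv : ¬ IsLight G v) (F : ℤ) (hF : F = (G.degree v : ℤ) * (5 + 2) - 4 * 5 +
      ∑ u ∈ G.neighborFinset v, (chargeFive G u v - chargeFive G v u)) :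
    0 ≤ F ∧ (F = 0 → (G.degree v = 5 ∧ bigNeighbors G v = ∅) ∨
      (G.degree v = 3 ∧ twoNeighbors G v = ∅ ∧ ∃ u, G.Adj v u ∧ IsLight G u)) := by
  classical
  have hd := card_twoNeighbors_add (G := G) v
  have h2 := hm.two_le_degree le_rfl v
  have hA := hm.le_of_twoNeighbors le_rfl (v := v)
  have hval : ∑ u ∈ bigNeighbors G v, (chargeFive G u v - chargeFive G v u) =
      -((bigNeighbors G v).filter (IsLight G)).card := by
    rw [Finset.card_filter]
    push_cast
    rw [← Finset.sum_neg_distrib]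
    refine Finset.sum_congr rfl fun u hu => ?_
    rw [mem_bigNeighbors] at hu
    simp [chargeFive, hu.2, hv2, hv]
  rw [sum_neighborFinset, sum_twoNeighbors_chargeFive hv2, hval] at hF
  have hb := Finset.card_filter_le (bigNeighbors G v) (IsLight G)
  have hb0 : ((bigNeighbors G v).filter (IsLight G)).card ≠ 0 → ∃ u, G.Adj v u ∧ IsLight G u := by
    intro h
    obtain ⟨u, hu⟩ := Finset.card_pos.1 (Nat.pos_of_ne_zero h)
    rw [Finset.mem_filter, mem_bigNeighbors] at hu
    exact ⟨u, hu.1.1, hu.2⟩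
  have hb3 : G.degree v = 3 → ((bigNeighbors G v).filter (IsLight G)).card ≤ 1 := by
    intro h3
    refine Finset.card_le_one.2 fun x hx y hy => ?_
    rw [Finset.mem_filter, mem_bigNeighbors] at hx hy
    exact hm.eq_of_isLight h3 hx.2 hy.2 hx.1.1 hy.1.1
  have hbE : (twoNeighbors G v).card + 2 * (bigNeighbors G v).card ≤ 6 →
      1 ≤ (twoNeighbors G v).card → G.degree v ≤ 4 →
      ((bigNeighbors G v).filter (IsLight G)).card = 0 := by
    intro h6 hk h4
    by_contra h
    obtain ⟨u, hvu, hu⟩ := hb0 h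
    exact hm.false_of_adj le_rfl hvu.symm hu.1 hk hu.2.2.le h6 hu.two_lt_degree.ne' hv2 (by omega)
  rw [← Finset.card_eq_zero, ← Finset.card_eq_zero]
  unfold IsLight at hv
  generalize ((bigNeighbors G v).filter (IsLight G)).card = b at *
  generalize (twoNeighbors G v).card = k at *
  generalize (bigNeighbors G v).card = m at *
  generalize G.degree v = d at *
  subst hd
  push_cast at hF
  by_cases h5 : 5 ≤ k + m
  · exact ⟨by omega, fun h0 => .inl (by omega)⟩
  by_cases hk : 1 ≤ k
  · have := hA hk
    have : 6 ≤ k + 2 * m := by omega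
    have := fun h => hbE h hk
    constructor
    · omega
    · omega
  · have h0 : k = 0 := by omega
    subst h0
    refine ⟨by omega, fun h0 => .inr ⟨by omega, rfl, hb0 (by omega)⟩⟩

theorem IsMinimalBad.structure_of_eq_five (hm : IsMinimalBad G 5)
    (hE : (5 + 2) * ∑ v, G.degree v ≤ 4 * 5 * Fintype.card V) (v : V) :
    G.degree v = 2 ∨ (G.degree v = 5 ∧ bigNeighbors G v = ∅) := by
  have hz := charge_eq_zero (G := G) _ (chargeFive G) (sum_charge_nonpos hE) (by
    intro v
    by_cases h2 : G.degree v = 2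
    · exact (hm.charge_five_of_eq_two h2).ge
    by_cases h3 : IsLight G v
    · exact (hm.charge_five_of_isLight h3).ge
    · exact (hm.charge_five_of_not_isLight h2 h3 _ rfl).1)
  have h4 := fun v h2 h3 => (hm.charge_five_of_not_isLight (v := v) h2 h3 _ rfl).2 (hz v)
  have h4' : ∀ x y, G.degree x ≠ 2 → ¬ IsLight G x → G.Adj x y → G.degree y ≠ 2 →
      G.degree x = 3 ∧ twoNeighbors G x = ∅ ∧ ∃ u, G.Adj x u ∧ IsLight G u := by
    intro x y hx hlx hxy hy
    refine (h4 x hx hlx).resolve_left fun h => ?_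
    have : y ∈ bigNeighbors G x := by simp [hxy, hy]
    simp [h.2] at this
  have hno : ∀ v, ¬ IsLight G v := by
    intro v hv
    have hv2 := hv.two_lt_degree.ne'
    obtain ⟨y, hy⟩ := Finset.card_pos.1 hv.2.1
    rw [mem_bigNeighbors] at hy
    obtain ⟨hy3, hyk, -⟩ := h4' y v hy.2 (hm.not_isLight_of_adj hv hy.1) hy.1.symm hv2
    have hybig : ∀ x, G.Adj y x → G.degree x ≠ 2 := by
      intro x hyx hx
      have : x ∈ twoNeighbors G y := by simp [hyx, hx]
      simp [hyk] at this
    obtain ⟨z, hyz, hzv, hvz⟩ : ∃ z, G.Adj y z ∧ z ≠ v ∧ ¬ G.Adj v z := by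
      by_contra! hcon
      have hsub : insert y ((G.neighborFinset y).erase v) ⊆ bigNeighbors G v := by
        intro x hx
        rw [mem_bigNeighbors]
        rcases Finset.mem_insert.1 hx with rfl | hx
        · exact hy
        · rw [Finset.mem_erase, mem_neighborFinset] at hx
          exact ⟨hcon x hx.2 hx.1, hybig x hx.2⟩
      have := Finset.card_le_card hsub
      rw [Finset.card_insert_of_notMem (by simp), Finset.card_erase_of_mem
        (by simpa using hy.1.symm), card_neighborFinset_eq_degree, hy3] at this
      have := hv.2
      have := hv.1
      omega
    obtain ⟨hz3, hzk, w, hzw, hw⟩ := h4' z y (hybig z hyz)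
      (fun h => hzv (hm.eq_of_isLight hy3 h hv hyz hy.1.symm)) hyz.symm hy.2
    refine hm.false_of_isLight hv hw hy3 hz3 hybig hzk hy.1.symm hyz hzw fun hyw => hvz ?_
    rw [hm.eq_of_isLight hy3 hv hw hy.1.symm hyw]
    exact hzw.symm
  refine or_iff_not_imp_left.2 fun h2 => (h4 v h2 (hno v)).resolve_right ?_
  rintro ⟨-, -, u, -, hu⟩
  exact hno u hu

theorem IsMinimalBad.degree_eq {c : ℕ} (hm : IsMinimalBad G c) (hc : 5 ≤ c)
    (hE : (c + 2) * ∑ v, G.degree v ≤ 4 * c * Fintype.card V) (v : V) :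
    G.degree v = 2 ∨ (G.degree v = c ∧ bigNeighbors G v = ∅) := by
  rcases hc.eq_or_lt with rfl | hc
  · exact hm.structure_of_eq_five hE v
  · exact hm.structure_of_six_le hc hE v

end DischargingFive

section LinkGraph

variable {V : Type*} [Fintype V] {c : ℕ} (G : SimpleGraph V) [DecidableRel G.Adj]

/-- Two vertices of degree other than two are adjacent if they have a common neighbor of degree
two. -/
def linkGraph : SimpleGraph V where
  Adj x y := x ≠ y ∧ G.degree x ≠ 2 ∧ G.degree y ≠ 2 ∧ ∃ u, G.degree u = 2 ∧ G.Adj u x ∧ G.Adj u y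
  symm := ⟨fun _ _ ⟨h, hx, hy, u, hu, hux, huy⟩ => ⟨h.symm, hy, hx, u, hu, huy, hux⟩⟩
  loopless := ⟨fun _ h => h.1 rfl⟩

variable {G} [DecidableEq V]

theorem eq_or_eq_of_degree_eq_two {u x y z : V} (hu : G.degree u = 2) (hx : G.Adj u x)
    (hy : G.Adj u y) (hz : G.Adj u z) (hxy : x ≠ y) : z = x ∨ z = y := by
  by_contra! hcon
  have hsub : ({z, x, y} : Finset V) ⊆ G.neighborFinset u := by
    simp [Finset.insert_subset_iff, hx, hy, hz]
  have := Finset.card_le_card hsub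
  rw [Finset.card_eq_three.2 ⟨z, x, y, hcon.1, hcon.2, hxy, rfl⟩, card_neighborFinset_eq_degree,
    hu] at this
  omega

theorem degree_linkGraph_le [DecidableRel (linkGraph G).Adj] (x : V) :
    (linkGraph G).degree x ≤ G.degree x := by
  have hex : ∀ y, (linkGraph G).Adj x y → ∃ u, G.degree u = 2 ∧ G.Adj u x ∧ G.Adj u y :=
    fun y h => h.2.2.2
  choose! φ hφ using hex
  refine Finset.card_le_card_of_injOn φ (fun y hy => ?_) fun y hy z hz hyz => ?_
  · simp at hy ⊢
    exact (hφ y hy).2.1.symm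
  · simp at hy hz
    have h1 := hφ y hy
    have h2 := hφ z hz
    rw [← hyz] at h2
    exact ((eq_or_eq_of_degree_eq_two h1.1 h1.2.1 h1.2.2 h2.2.2 hy.1).resolve_left hz.1.symm).symm

/-- A clique in the link graph spans a subdivided clique. -/
theorem containsSubgraph_of_not_cliqueFree {n : ℕ} (h : ¬ (linkGraph G).CliqueFree n) (hn : 2 ≤ n) :
    ContainsSubgraph G (KStarGraph n) := by
  have s := topEmbeddingOfNotCliqueFree h
  have hs : ∀ i j, i ≠ j → (linkGraph G).Adj (s i) (s j) :=
    fun i j hij => s.map_rel_iff.2 hij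
  have hdeg : ∀ i, G.degree (s i) ≠ 2 := by
    intro i
    have : Nontrivial (Fin n) := Fin.nontrivial_iff_two_le.2 hn
    obtain ⟨j, hj⟩ := exists_ne i
    exact (hs i j hj.symm).2.1
  have hex : ∀ e : (completeGraph (Fin n)).edgeSet,
      ∃ u, G.degree u = 2 ∧ ∀ i ∈ (e : Sym2 (Fin n)), G.Adj (s i) u := by
    rintro ⟨e, he⟩
    induction e using Sym2.ind with
    | _ i j =>
      obtain ⟨-, -, -, u, hu, hi, hj⟩ := hs i j he
      refine ⟨u, hu, fun k hk => ?_⟩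
      rcases Sym2.mem_iff.1 hk with rfl | rfl
      exacts [hi.symm, hj.symm]
  choose φ hφ2 hφ using hex
  have hφinj : Function.Injective φ := by
    rintro ⟨e, he⟩ ⟨e', he'⟩ hee
    have h1 := hφ ⟨e, he⟩
    have h2 := hφ ⟨e', he'⟩
    have hd := hφ2 ⟨e, he⟩
    rw [← hee] at h2
    induction e using Sym2.ind with
    | _ i j =>
    induction e' using Sym2.ind with
    | _ k l =>
    have hij : i ≠ j := he
    have hkl : k ≠ l := he'
    have key : ∀ m ∈ s(k, l), m = i ∨ m = j := fun m hm =>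
      (eq_or_eq_of_degree_eq_two hd (h1 i (by simp)).symm (h1 j (by simp)).symm (h2 m hm).symm
        (s.injective.ne hij)).imp (fun h => s.injective h) fun h => s.injective h
    have hk := key k (by simp)
    have hl := key l (by simp)
    simp only [Subtype.mk.injEq, Sym2.eq_iff]
    grind
  refine ⟨Sum.elim s φ, ?_, ?_⟩
  · refine s.injective.sumElim hφinj fun i e h => hdeg i ?_
    rw [h]
    exact hφ2 e
  · rintro (i | e) (j | e') hadj <;> simp [KStarGraph, Subdiv] at hadj ⊢
    · exact hφ e' i hadj
    · exact (hφ e j hadj).symm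

theorem IsMinimalBad.containsSubgraph (hm : IsMinimalBad G c) (hc : 5 ≤ c)
    (hE : (c + 2) * ∑ v, G.degree v ≤ 4 * c * Fintype.card V) :
    ContainsSubgraph G (KStarGraph (c + 1)) := by
  classical
  have hdeg := hm.degree_eq hc hE
  refine containsSubgraph_of_not_cliqueFree (fun hfree => ?_) (by omega)
  obtain ⟨f, hf⟩ := brooks (by omega) (fun x => (degree_linkGraph_le x).trans (by
    rcases hdeg x with h | h <;> omega)) hfree
  have hbig : ∀ x y, G.degree x ≠ 2 → G.Adj x y → G.degree y = 2 := by
    intro x y hx hxy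
    by_contra hy
    have : y ∈ bigNeighbors G x := by simp [hxy, hy]
    simp [((hdeg x).resolve_left hx).2] at this
  have hpart : IsPartialPCF G (Finset.univ.filter fun x => G.degree x = 2)ᶜ f ∅ := by
    refine ⟨fun x hx y hy hxy => ?_, fun t _ ⟨x, hx, htx⟩ => ?_⟩
    · simp at hx hy
      exact absurd (hbig x y hx hxy) hy
    · simp at hx
      have ht := hbig x t hx htx.symm
      obtain ⟨p, q, hpq, hN⟩ := Finset.card_eq_two.1 ht
      have htp : G.Adj t p := by rw [← mem_neighborFinset, hN]; simp
      have htq : G.Adj t q := by rw [← mem_neighborFinset, hN]; simp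
      have hp := hm.degree_ne_two_of_adj hc ht htp
      have hq := hm.degree_ne_two_of_adj hc ht htq
      exact hasUniqueColor_of_ne (by omega) (by simpa using hp) (by simpa using hq) htp htq
        (hf p q ⟨hpq, hp, hq, t, ht, htp, htq⟩)
  exact hm.false_of_isPartialPCF hc hpart (by simp) (by simp) (by simp)

end LinkGraph

/-- The degree sum of an induced subgraph is bounded by the maximum average degree. -/
theorem sum_degree_induce_le {V : Type*} [Fintype V] {c : ℕ} {G : SimpleGraph V}
    (hmad : MadLE G ((4 * c : ℚ) / ((c : ℚ) + 2))) (A : Finset V)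
    [DecidableRel (G.induce (A : Set V)).Adj] :
    (c + 2) * ∑ v, (G.induce (A : Set V)).degree v ≤
      4 * c * Fintype.card (A : Set V) := by
  rcases A.eq_empty_or_nonempty with rfl | hA
  · simp
  have h := hmad ((⊤ : G.Subgraph).induce A) (by simpa using hA)
  have hcard : ((⊤ : G.Subgraph).induce (A : Set V)).edgeSet.ncard =
      (G.induce (A : Set V)).edgeFinset.card := by
    have hE : (G.induce (A : Set V)).edgeSet.ncard = (G.induce (A : Set V)).edgeFinset.card := by
      rw [← coe_edgeFinset, Set.ncard_coe_finset]
    rw [← hE, ← Subgraph.image_coe_edgeSet_coe,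
      Set.ncard_image_of_injective _ (Sym2.map.injective Subtype.val_injective)]
    exact congrArg (fun H : SimpleGraph (A : Set V) => H.edgeSet.ncard)
      (induce_eq_coe_induce_top (A : Set V)).symm
  rw [hcard, Subgraph.induce_verts, Set.ncard_coe_finset, div_mul_eq_mul_div,
    le_div_iff₀ (by positivity)] at h
  rw [sum_degrees_eq_twice_card_edges]
  simp only [Finset.coe_sort_coe, Fintype.card_coe]
  have hq : ((c + 2 : ℕ) * (2 * (G.induce (A : Set V)).edgeFinset.card) : ℚ) ≤
      (4 * c * A.card : ℕ) := by
    push_cast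
    linarith
  exact_mod_cast hq

/-- A minimal vertex set without PCF coloring induces a minimal bad graph. -/
theorem isMinimalBad_induce {V : Type*} [Fintype V] [DecidableEq V] {c : ℕ} (hc : 5 ≤ c)
    {G : SimpleGraph V} {A : Finset V}
    (hA : Minimal (fun B : Finset V => ¬ ∃ f : V → Fin c, IsPartialPCF G B f Bᶜ) A) :
    IsMinimalBad (G.induce (A : Set V)) c := by
  constructor
  · intro R hR
    obtain ⟨B, hsub, hBmem⟩ : ∃ B ⊆ A, ∀ x : (A : Set V), x.1 ∈ B ↔ x ∉ R := by
      refine ⟨Rᶜ.map (Function.Embedding.subtype _), fun x hx => ?_, fun x => by simp⟩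
      simp at hx
      exact hx.1
    have hBA : B ⊂ A := by
      obtain ⟨r, hr⟩ := hR
      refine Finset.ssubset_iff_subset_ne.2 ⟨hsub, fun h => ?_⟩
      · exact (hBmem r).1 (h ▸ r.2) hr
    obtain ⟨f, hf⟩ := not_not.1 (hA.not_prop_of_lt hBA)
    refine ⟨fun x => f x.1, fun x hx y hy hxy => ?_, fun t ht ⟨u, hu, htu⟩ => ?_⟩
    · exact hf.proper x ((hBmem x).2 (by simpa using hx)) y ((hBmem y).2 (by simpa using hy)) hxy
    · obtain ⟨w, hw, htw, huniq⟩ := hf.unique t (by simpa using (hBmem t).2 ht)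
        ⟨u, (hBmem u).2 (by simpa using hu), htu⟩
      refine ⟨⟨w, hBA.1 hw⟩, ?_, htw, fun x hx htx hfx => ?_⟩
      · simpa using (hBmem ⟨w, hBA.1 hw⟩).1 hw
      · exact Subtype.ext (huniq x ((hBmem x).2 (by simpa using hx)) htx hfx)
  · rintro ⟨f, hf⟩
    refine hA.prop ⟨fun x => if hx : x ∈ A then f ⟨x, hx⟩ else ⟨0, by omega⟩,
      fun x hx y hy hxy => ?_, fun t ht ⟨u, hu, htu⟩ => ?_⟩
    · simp only [hx, hy, dif_pos]
      exact hf.proper ⟨x, hx⟩ (by simp) ⟨y, hy⟩ (by simp) hxy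
    · have htA : t ∈ A := by simpa using ht
      obtain ⟨w, -, htw, huniq⟩ := hf.unique ⟨t, htA⟩ (by simp) ⟨⟨u, hu⟩, by simp, htu⟩
      have hwA : w.1 ∈ A := w.2
      refine ⟨w, hwA, htw, fun x hx htx hfx => ?_⟩
      simp only [hx, hwA, dif_pos] at hfx
      exact congrArg Subtype.val (huniq ⟨x, hx⟩ (by simp) htx hfx)

/-- For every integer `c ≥ 5`, if `G` is a finite simple graph with
`mad(G) ≤ 4c/(c+2)` and `G` does not contain `K*_{c+1}` as a subgraph,
then `G` has a proper conflict-free `c`-coloring. -/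
theorem pcf_of_madLE {c : ℕ} (hc : 5 ≤ c) {V : Type*} [Fintype V] (G : SimpleGraph V)
    (hmad : MadLE G ((4 * c : ℚ) / ((c : ℚ) + 2)))
    (hK : ¬ ContainsSubgraph G (KStarGraph (c + 1))) :
    ∃ f : V → Fin c, IsPCFColoring G f := by
  classical
  by_cases hex : ∃ f : V → Fin c, IsPartialPCF G Finset.univ f Finset.univᶜ
  · obtain ⟨f, hf⟩ := hex
    refine ⟨f, fun u v huv => hf.proper u (by simp) v (by simp) huv, fun v ⟨u, hu⟩ => ?_⟩
    obtain ⟨u, -, hvu, huniq⟩ := hf.unique v (by simp) ⟨u, by simp, hu⟩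
    exact ⟨u, hvu, fun w => huniq w (by simp)⟩
  · obtain ⟨A, hA⟩ := exists_minimal_of_wellFoundedLT
      (fun B : Finset V => ¬ ∃ f : V → Fin c, IsPartialPCF G B f Bᶜ) ⟨_, hex⟩
    obtain ⟨φ, hφ, hadj⟩ := (isMinimalBad_induce hc hA).containsSubgraph hc
      (sum_degree_induce_le hmad A)
    exact absurd ⟨fun x => φ x, Subtype.val_injective.comp hφ, fun a b hab => hadj hab⟩ hK
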